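/- For every even n ≥ 1000 and every γ > 0, δ¹(γ, n) ≤ 2804655 · γ / n. -/

import Mathlib

open Finset

noncomputable def stdNormalCDF (t : ℝ) : ℝ :=
  (Real.sqrt (2 * Real.pi))⁻¹ * ∫ x in Set.Iic t, Real.exp (-(x ^ 2) / 2)

/-- The set of fixed-point-free involutions of `{1,…,n}`. -/
def fpfInvolutions (n : ℕ) : Finset (Equiv.Perm (Fin n)) :=
  Finset.univ.filter fun π => π * π = 1 ∧ ∀ i, π i ≠ i

/-- Distribution function of `Y_E = Σ e_{iπ(i)}` for `π` uniform on `Π_n`. -/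
noncomputable def cdfYE (n : ℕ) (e : Fin n → Fin n → ℝ) (t : ℝ) : ℝ :=
  (((fpfInvolutions n).filter (fun π => ∑ i, e i (π i) ≤ t)).card : ℝ) /
    ((fpfInvolutions n).card : ℝ)

/-- `δ_E = sup_t |F_E(t) − Φ(t)|`. -/
noncomputable def deltaArr (n : ℕ) (e : Fin n → Fin n → ℝ) : ℝ :=
  ⨆ t : ℝ, |cdfYE n e t - stdNormalCDF t|

/-- Membership in `M_n(γ)`. -/
def memM (n : ℕ) (γ : ℝ) (e : Fin n → Fin n → ℝ) : Prop :=
  (∀ i j, e i j = e j i) ∧ (∀ i, e i i = 0) ∧ (∀ i, ∑ j, e i j = 0) ∧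
  2 * ((n : ℝ) - 2) / (((n : ℝ) - 1) * ((n : ℝ) - 3)) * (∑ i, ∑ j, e i j ^ 2) = 1 ∧
  (∑ i, ∑ j, if i ≠ j then |e i j| ^ 3 else 0) ≤ γ

/-- Membership in `M_n¹(γ)`: additionally all entries are bounded by 1. -/
def memM1 (n : ℕ) (γ : ℝ) (e : Fin n → Fin n → ℝ) : Prop :=
  memM n γ e ∧ ∀ i j, |e i j| ≤ 1

/-- `δ¹(γ, n) = sup_{E ∈ M_n¹(γ)} δ_E`. -/
noncomputable def delta1 (γ : ℝ) (n : ℕ) : ℝ :=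
  ⨆ e : {e : Fin n → Fin n → ℝ // memM1 n γ e}, deltaArr n e.val

namespace Matching

open scoped BigOperators

set_option linter.unusedSectionVars false

section Average

variable {P V κ : Type*} [Fintype P] [DecidableEq P] [Fintype V] [DecidableEq V]
  [Fintype κ] [DecidableEq κ]

/-- `w σ` only depends on the restriction of the labelling `σ` to the positions in `A`. -/
def LocalOn {α : Type*} (A : Finset P) (w : (P ≃ V) → α) : Prop :=
  ∀ g : Equiv.Perm P, (∀ p ∈ A, g p = p) → ∀ σ, w (g.trans σ) = w σ

theorem expect_perm (g : Equiv.Perm P) (F : (P ≃ V) → ℝ) :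
    𝔼 σ, F (g.trans σ) = 𝔼 σ, F σ :=
  Fintype.expect_equiv
    ⟨fun σ => g.trans σ, fun σ => g.symm.trans σ, fun σ => by ext; simp, fun σ => by ext; simp⟩
    _ _ fun _ => rfl

theorem exists_perm_of_embeddings (A : Finset P) (t t' : κ ↪ P) (ht : ∀ i, t i ∉ A)
    (ht' : ∀ i, t' i ∉ A) : ∃ g : Equiv.Perm P, (∀ p ∈ A, g p = p) ∧ ∀ i, g (t i) = t' i := by
  classical
  let f : P → P := fun x => if h : ∃ i, t i = x then t' h.choose else x
  have hft : ∀ i, f (t i) = t' i := by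
    intro i
    have h : ∃ j, t j = t i := ⟨i, rfl⟩
    simp only [f, dif_pos h]
    exact congrArg t' (t.injective h.choose_spec)
  have hfA : ∀ p ∈ A, f p = p := by
    intro p hp
    have h : ¬ ∃ j, t j = p := by
      rintro ⟨j, rfl⟩
      exact ht j hp
    simp only [f, dif_neg h]
  obtain ⟨g, hg⟩ := Finset.exists_equiv_extend_of_card_eq (α := P) (t := (univ : Finset P)) rfl
    (s := A ∪ univ.map t) (f := f) (by simp) (by
      intro x hx y hy hxy
      simp only [coe_union, coe_map, coe_univ, Set.image_univ, Set.mem_union, mem_coe,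
        Set.mem_range] at hx hy
      rcases hx with hx | ⟨i, rfl⟩ <;> rcases hy with hy | ⟨j, rfl⟩
      · rwa [hfA x hx, hfA y hy] at hxy
      · rw [hfA x hx, hft] at hxy
        exact absurd (hxy ▸ hx) (ht' j)
      · rw [hfA y hy, hft] at hxy
        exact absurd (hxy ▸ hy) (ht' i)
      · rw [hft, hft] at hxy
        rw [t'.injective hxy])
  refine ⟨g.trans (Equiv.subtypeUnivEquiv (by simp)), fun p hp => ?_, fun i => ?_⟩
  · simpa [hfA p hp] using hg p (by simp [hp])
  · simpa [hft i] using hg (t i) (by simp)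

theorem expect_tuple_eq {A : Finset P} {G : (P ≃ V) → (κ → V) → ℝ} (hG : LocalOn A G)
    (t t' : κ ↪ P) (ht : ∀ i, t i ∉ A) (ht' : ∀ i, t' i ∉ A) :
    𝔼 σ, G σ (fun i => σ (t i)) = 𝔼 σ, G σ (fun i => σ (t' i)) := by
  obtain ⟨g, hgA, hgt⟩ := exists_perm_of_embeddings A t t' ht ht'
  rw [← expect_perm g]
  refine Finset.expect_congr rfl fun σ _ => ?_
  rw [hG g hgA]
  simp [hgt]

/-- A tuple of positions off `A` may be averaged over all such tuples. -/
theorem expect_tuple_eq_expect {A : Finset P} {G : (P ≃ V) → (κ → V) → ℝ} (hG : LocalOn A G)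
    (t : κ ↪ P) (ht : ∀ i, t i ∉ A) :
    𝔼 σ, G σ (fun i => σ (t i)) =
      𝔼 σ, 𝔼 s : κ ↪ {p // p ∉ A}, G σ (fun i => σ (s i)) := by
  rw [Finset.expect_comm]
  have : Nonempty (κ ↪ {p // p ∉ A}) :=
    ⟨⟨fun i => ⟨t i, ht i⟩, fun i j h => t.injective (by simpa using h)⟩⟩
  have h : ∀ s : κ ↪ {p // p ∉ A}, 𝔼 σ, G σ (fun i => σ (s i)) = 𝔼 σ, G σ (fun i => σ (t i)) :=
    fun s => expect_tuple_eq hG (s.trans (Function.Embedding.subtype _)) t (fun i => (s i).2) ht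
  rw [Finset.expect_congr rfl fun s _ => h s, Finset.expect_const univ_nonempty]

theorem localOn_expect {A : Finset P} (q : (κ → V) → ℝ) :
    LocalOn A fun σ : P ≃ V => 𝔼 s : κ ↪ {p // p ∉ A}, q (fun i => σ (s i)) := by
  intro g hg σ
  have hg' : ∀ p, p ∉ A ↔ g p ∉ A := by
    intro p
    refine not_congr ⟨fun h => by rwa [hg p h], fun h => ?_⟩
    have := hg _ h
    rwa [g.injective this] at h
  refine Fintype.expect_equiv (Equiv.embeddingCongr (Equiv.refl κ) (g.subtypeEquiv hg')) _ _ ?_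
  intro s
  simp [Equiv.embeddingCongr]

theorem LocalOn.mul {A : Finset P} {v w : (P ≃ V) → ℝ} (hv : LocalOn A v) (hw : LocalOn A w) :
    LocalOn A fun σ => v σ * w σ := fun g hg σ => by
  simp only [hv g hg, hw g hg]

/-- Summing out one position. -/
theorem expect_sum_out {A : Finset P} {G : (P ≃ V) → V → ℝ} (hG : LocalOn A G) {p : P}
    (hp : p ∉ A) :
    ((Fintype.card P : ℝ) - #A) * 𝔼 σ, G σ (σ p) = 𝔼 σ, ∑ r ∈ Aᶜ, G σ (σ r) := by
  rw [Finset.expect_sum_comm]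
  have h : ∀ r ∈ Aᶜ, 𝔼 σ, G σ (σ r) = 𝔼 σ, G σ (σ p) := by
    intro r hr
    let c : P → Unit ↪ P := fun r => ⟨fun _ => r, fun _ _ _ => rfl⟩
    exact expect_tuple_eq (κ := Unit) (G := fun σ x => G σ (x ()))
      (fun g hg σ => by simp only [hG g hg]) (c r) (c p)
      (fun _ => (by simpa using hr : r ∉ A)) (fun _ => hp)
  rw [Finset.sum_congr rfl h, Finset.sum_const, Finset.card_compl, nsmul_eq_mul,
    Nat.cast_sub (Finset.card_le_univ A)]

end Average

section Clip

/-- The identity on `[-δ, ℓ + δ]`, recentred and truncated outside. -/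
noncomputable def clip (ℓ δ x : ℝ) : ℝ := max (-(ℓ / 2 + δ)) (min (ℓ / 2 + δ) (x - ℓ / 2))

theorem abs_clip_le {ℓ δ : ℝ} (hℓ : 0 ≤ ℓ) (hδ : 0 < δ) (x : ℝ) : |clip ℓ δ x| ≤ ℓ / 2 + δ := by
  unfold clip
  rw [abs_le]
  exact ⟨le_max_left _ _, max_le (by linarith) (min_le_left _ _)⟩

theorem clip_mono (ℓ δ : ℝ) : Monotone (clip ℓ δ) := fun x y h =>
  max_le_max le_rfl (min_le_min le_rfl (by linarith))

theorem mul_clip_sub_nonneg (ℓ δ x d : ℝ) : 0 ≤ d * (clip ℓ δ (x + d) - clip ℓ δ x) := by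
  rcases le_total 0 d with h | h
  · exact mul_nonneg h (sub_nonneg.2 (clip_mono _ _ (by linarith)))
  · exact mul_nonneg_of_nonpos_of_nonpos h (sub_nonpos.2 (clip_mono _ _ (by linarith)))

theorem abs_mul_min_le_mul_clip_sub {ℓ δ x : ℝ} (hδ : 0 < δ) (h0 : 0 ≤ x) (h1 : x ≤ ℓ) (d : ℝ) :
    |d| * min |d| δ ≤ d * (clip ℓ δ (x + d) - clip ℓ δ x) := by
  have hx : clip ℓ δ x = x - ℓ / 2 := by
    unfold clip
    rw [min_eq_right (by linarith), max_eq_right (by linarith)]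
  rw [hx]
  rcases le_total 0 d with h | h
  · rw [abs_of_nonneg h]
    refine mul_le_mul_of_nonneg_left ?_ h
    have : x - ℓ / 2 + min d δ ≤ clip ℓ δ (x + d) := by
      unfold clip
      refine le_max_of_le_right (le_min ?_ ?_)
      · have := min_le_right d δ
        linarith
      · have := min_le_left d δ
        linarith
    linarith
  · rw [abs_of_nonpos h]
    have : clip ℓ δ (x + d) ≤ x - ℓ / 2 - min (-d) δ := by
      unfold clip
      refine max_le ?_ (min_le_of_right_le ?_)
      · have := min_le_right (-d) δ
        linarith
      · have := min_le_left (-d) δ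
        linarith
    nlinarith

end Clip

section Concentration

variable {P V : Type*} [Fintype P] [DecidableEq P] [Fintype V] [DecidableEq V]

theorem LocalOn.mul_const_tuple {κ : Type*} {A : Finset P} {w : (P ≃ V) → ℝ} (hw : LocalOn A w)
    (q : (κ → V) → ℝ) : LocalOn A fun σ x => w σ * q x := fun g hg σ => by
  funext x
  simp only [hw g hg]

theorem expect_mul_tuple {κ : Type*} [Fintype κ] [DecidableEq κ] {A : Finset P}
    {w : (P ≃ V) → ℝ} (hw : LocalOn A w) (q : (κ → V) → ℝ) (t : κ ↪ P) (ht : ∀ i, t i ∉ A) :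
    𝔼 σ, w σ * q (fun i => σ (t i)) =
      𝔼 σ, w σ * 𝔼 s : κ ↪ {p // p ∉ A}, q (fun i => σ (s i)) := by
  rw [expect_tuple_eq_expect (hw.mul_const_tuple q) t ht]
  simp only [Finset.mul_expect]

/-- Two disjoint tuples of positions are almost negatively correlated. -/
theorem expect_mul_tuple_mul_tuple_le {A : Finset P} {w : (P ≃ V) → ℝ} (hw : LocalOn A w)
    (hw0 : ∀ σ, 0 ≤ w σ) (q : (Fin 4 → V) → ℝ) (hq : ∀ x, 0 ≤ q x) (t : Fin 4 ⊕ Fin 4 ↪ P)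
    (ht : ∀ i, t i ∉ A) {r : ℝ}
    (hr : (Fintype.card (Fin 4 ↪ {p // p ∉ A}) : ℝ) ^ 2 ≤
      (1 + r) * Fintype.card (Fin 4 ⊕ Fin 4 ↪ {p // p ∉ A})) :
    𝔼 σ, w σ * (q (fun i => σ (t (.inl i))) * q (fun i => σ (t (.inr i)))) ≤
      (1 + r) * 𝔼 σ, w σ * (𝔼 s : Fin 4 ↪ {p // p ∉ A}, q (fun i => σ (s i))) ^ 2 := by
  have hne : Nonempty (Fin 4 ⊕ Fin 4 ↪ {p // p ∉ A}) :=
    ⟨⟨fun i => ⟨t i, ht i⟩, fun i j h => t.injective (by simpa using h)⟩⟩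
  have hne' : Nonempty (Fin 4 ↪ {p // p ∉ A}) :=
    hne.map fun t => Function.Embedding.inl.trans t
  rw [expect_mul_tuple hw (fun x => q (fun i => x (.inl i)) * q (fun i => x (.inr i))) t ht,
    Finset.mul_expect]
  refine Finset.expect_le_expect fun σ _ => ?_
  rw [mul_left_comm]
  refine mul_le_mul_of_nonneg_left ?_ (hw0 σ)
  rw [Fintype.expect_eq_sum_div_card, Fintype.expect_eq_sum_div_card]
  have hsum : ∑ s : Fin 4 ⊕ Fin 4 ↪ {p // p ∉ A},
      q (fun i => σ (s (.inl i))) * q (fun i => σ (s (.inr i))) ≤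
      (∑ s : Fin 4 ↪ {p // p ∉ A}, q (fun i => σ (s i))) ^ 2 := by
    rw [sq, Finset.sum_mul_sum, ← Finset.sum_product']
    let φ : (Fin 4 ⊕ Fin 4 ↪ {p // p ∉ A}) ↪
        (Fin 4 ↪ {p // p ∉ A}) × (Fin 4 ↪ {p // p ∉ A}) :=
      ⟨fun s => (Function.Embedding.inl.trans s, Function.Embedding.inr.trans s), by
        intro s s' h
        refine DFunLike.ext _ _ fun i => ?_
        rcases i with i | i
        · simpa using DFunLike.congr_fun (congrArg Prod.fst h) i
        · simpa using DFunLike.congr_fun (congrArg Prod.snd h) i⟩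
    have := Finset.sum_map univ φ
      (fun x => q (fun i => σ (x.1 i)) * q (fun i => σ (x.2 i)))
    refine le_trans (le_of_eq ?_) (Finset.sum_le_sum_of_subset_of_nonneg
      (Finset.subset_univ (univ.map φ)) fun x _ _ => mul_nonneg (hq _) (hq _))
    rw [this]
    rfl
  have h8 : (0 : ℝ) < Fintype.card (Fin 4 ⊕ Fin 4 ↪ {p // p ∉ A}) := by
    exact_mod_cast Fintype.card_pos
  have h4 : (0 : ℝ) < Fintype.card (Fin 4 ↪ {p // p ∉ A}) := by
    exact_mod_cast Fintype.card_pos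
  rw [div_pow, ← mul_div_assoc, div_le_div_iff₀ h8 (by positivity)]
  set T := ∑ s : Fin 4 ↪ {p // p ∉ A}, q (fun i => σ (s i))
  calc _ ≤ T ^ 2 * ((1 + r) * Fintype.card (Fin 4 ⊕ Fin 4 ↪ {p // p ∉ A})) :=
        mul_le_mul hsum hr (by positivity) (by positivity)
    _ = _ := by ring

/-- Anti-concentration for a statistic that can be perturbed independently in `M` blocks of
four positions. -/
theorem concentration {M : ℕ} {A : Finset P} (B : Fin M × Fin 4 ↪ P) (hB : ∀ x, B x ∉ A)
    (D : (Fin 4 → V) → ℝ) (hD : ∀ x, D (fun i => x (Equiv.swap 1 2 i)) = -D x)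
    {w ℓ Z : (P ≃ V) → ℝ} (hw0 : ∀ σ, 0 ≤ w σ) (hℓ0 : ∀ σ, 0 ≤ ℓ σ) (hw : LocalOn A w)
    (hℓ : LocalOn A ℓ)
    (hZ : ∀ k σ, Z ((Equiv.swap (B (k, 1)) (B (k, 2))).trans σ) =
      Z σ + D (fun i => σ (B (k, i))))
    {δ η r C : ℝ} (hδ : 0 < δ) (hη : 0 < η)
    (hC : ∀ σ : P ≃ V, M * 𝔼 s : Fin 4 ↪ {p // p ∉ A}, D (fun i => σ (s i)) ^ 2 ≤ C)
    (h1 : ∀ σ : P ≃ V, 1 ≤ M * 𝔼 s : Fin 4 ↪ {p // p ∉ A},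
      |D (fun i => σ (s i))| * min |D (fun i => σ (s i))| δ)
    (hr0 : 0 ≤ r)
    (hr : (Fintype.card (Fin 4 ↪ {p // p ∉ A}) : ℝ) ^ 2 ≤
      (1 + r) * Fintype.card (Fin 4 ⊕ Fin 4 ↪ {p // p ∉ A})) :
    𝔼 σ, w σ * (if 0 ≤ Z σ ∧ Z σ ≤ ℓ σ then 1 else 0) ≤
      𝔼 σ, w σ * ((1 + C) / 2 * (ℓ σ + 2 * δ) + (η / 2 + (δ ^ 2 * C + r * C ^ 2) / (2 * η))) := by
  set v : (P ≃ V) → ℝ := fun σ => if 0 ≤ Z σ ∧ Z σ ≤ ℓ σ then 1 else 0 with hv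
  set q : (Fin 4 → V) → ℝ := fun x => |D x| * min |D x| δ with hq
  set d : Fin M → (P ≃ V) → ℝ := fun k σ => D (fun i => σ (B (k, i))) with hd
  set μ : (P ≃ V) → ℝ := fun σ => 𝔼 s : Fin 4 ↪ {p // p ∉ A}, q (fun i => σ (s i)) with hμ
  set m2 : (P ≃ V) → ℝ := fun σ => 𝔼 s : Fin 4 ↪ {p // p ∉ A}, D (fun i => σ (s i)) ^ 2 with hm2
  set S : (P ≃ V) → ℝ := fun σ => ∑ k, d k σ with hS
  set Q : (P ≃ V) → ℝ := fun σ => ∑ k, q (fun i => σ (B (k, i))) with hQ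
  have hv0 : ∀ σ, 0 ≤ v σ := fun σ => by simp only [hv]; split_ifs <;> norm_num
  have hv1 : ∀ σ, v σ ≤ 1 := fun σ => by simp only [hv]; split_ifs <;> norm_num
  have hq0 : ∀ x, 0 ≤ q x := fun x => mul_nonneg (abs_nonneg _) (le_min (abs_nonneg _) hδ.le)
  have hqD : ∀ x, q x ≤ D x ^ 2 := fun x => by
    rw [← sq_abs, sq]
    exact mul_le_mul_of_nonneg_left (min_le_left _ _) (abs_nonneg _)
  have hq2 : ∀ x, q x * q x ≤ δ ^ 2 * D x ^ 2 := fun x => by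
    have : q x ≤ |D x| * δ := mul_le_mul_of_nonneg_left (min_le_right _ _) (abs_nonneg _)
    calc q x * q x ≤ (|D x| * δ) * (|D x| * δ) := mul_self_le_mul_self (hq0 x) this
      _ = δ ^ 2 * |D x| ^ 2 := by ring
      _ = _ := by rw [sq_abs]
  let b : Fin M → Fin 4 ↪ P := fun k => ⟨fun i => B (k, i), fun i j h => by
    simpa using B.injective h⟩
  have hbA : ∀ k i, b k i ∉ A := fun k i => hB _
  -- effect of the block swaps
  have hswap : ∀ k l (σ : P ≃ V), d l ((Equiv.swap (B (k, 1)) (B (k, 2))).trans σ) =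
      if l = k then -d l σ else d l σ := by
    intro k l σ
    split_ifs with h
    · subst h
      simp only [hd]
      rw [← hD]
      congr 1
      funext i
      simp only [Equiv.trans_apply]
      exact congrArg σ ((b l).injective.swap_apply 1 2 i)
    · simp only [hd]
      congr 1
      funext i
      simp only [Equiv.trans_apply]
      rw [Equiv.swap_apply_of_ne_of_ne]
      · exact fun h' => h (congrArg Prod.fst (B.injective h'))
      · exact fun h' => h (congrArg Prod.fst (B.injective h'))
  have hfix : ∀ k, ∀ p ∈ A, Equiv.swap (B (k, 1)) (B (k, 2)) p = p := by
    intro k p hp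
    rw [Equiv.swap_apply_of_ne_of_ne]
    · rintro rfl; exact hB _ hp
    · rintro rfl; exact hB _ hp
  -- the truncated quadratic variation on the interval
  have step1 : 𝔼 σ, w σ * v σ * Q σ ≤ 𝔼 σ, w σ * (ℓ σ + 2 * δ) * |S σ| := by
    have hk : ∀ k, 𝔼 σ, w σ * v σ * q (fun i => σ (B (k, i))) ≤
        -2 * 𝔼 σ, w σ * d k σ * clip (ℓ σ) δ (Z σ) := by
      intro k
      have e1 : 𝔼 σ, w σ * d k σ * clip (ℓ σ) δ (Z σ) =
          -𝔼 σ, w σ * d k σ * clip (ℓ σ) δ (Z σ + d k σ) := by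
        rw [← expect_perm (Equiv.swap (B (k, 1)) (B (k, 2))), ← Finset.expect_neg_distrib]
        refine Finset.expect_congr rfl fun σ _ => ?_
        rw [hw _ (hfix k), hℓ _ (hfix k), hZ, hswap, if_pos rfl]
        ring
      have e2 : -2 * 𝔼 σ, w σ * d k σ * clip (ℓ σ) δ (Z σ) =
          𝔼 σ, w σ * (d k σ * (clip (ℓ σ) δ (Z σ + d k σ) - clip (ℓ σ) δ (Z σ))) := by
        simp only [mul_sub, Finset.expect_sub_distrib, ← mul_assoc]
        linarith
      rw [e2]
      refine Finset.expect_le_expect fun σ _ => ?_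
      rw [mul_assoc]
      refine mul_le_mul_of_nonneg_left ?_ (hw0 σ)
      simp only [hv]
      split_ifs with h
      · rw [one_mul]
        exact abs_mul_min_le_mul_clip_sub hδ h.1 h.2 _
      · rw [zero_mul]
        exact mul_clip_sub_nonneg _ _ _ _
    calc 𝔼 σ, w σ * v σ * Q σ = ∑ k, 𝔼 σ, w σ * v σ * q (fun i => σ (B (k, i))) := by
          rw [← Finset.expect_sum_comm]
          simp only [hQ, Finset.mul_sum]
      _ ≤ ∑ k, -2 * 𝔼 σ, w σ * d k σ * clip (ℓ σ) δ (Z σ) := Finset.sum_le_sum fun k _ => hk k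
      _ = 𝔼 σ, w σ * (-2 * (S σ * clip (ℓ σ) δ (Z σ))) := by
          rw [← Finset.mul_sum, ← Finset.expect_sum_comm, Finset.mul_expect]
          refine Finset.expect_congr rfl fun σ _ => ?_
          simp only [hS, Finset.sum_mul, Finset.mul_sum]
          exact Finset.sum_congr rfl fun k _ => by ring
      _ ≤ _ := by
          refine Finset.expect_le_expect fun σ _ => ?_
          rw [mul_assoc]
          refine mul_le_mul_of_nonneg_left ?_ (hw0 σ)
          have h1 := abs_clip_le (hℓ0 σ) hδ (Z σ)
          have h2 : |S σ * clip (ℓ σ) δ (Z σ)| ≤ |S σ| * (ℓ σ / 2 + δ) := by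
            rw [abs_mul]
            exact mul_le_mul_of_nonneg_left h1 (abs_nonneg _)
          have h3 := neg_abs_le (S σ * clip (ℓ σ) δ (Z σ))
          linarith
  -- second moment of the sum of the block differences
  have hdd : ∀ (u : (P ≃ V) → ℝ), (∀ σ, 0 ≤ u σ) → LocalOn A u → ∀ k,
      𝔼 σ, u σ * (d k σ * d k σ) = 𝔼 σ, u σ * m2 σ := by
    intro u hu0 hu k
    have := expect_mul_tuple hu (fun x => D x ^ 2) (b k) (hbA k)
    rw [← this]
    refine Finset.expect_congr rfl fun σ _ => ?_
    rw [← sq]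
    rfl
  have hSS : ∀ (u : (P ≃ V) → ℝ), (∀ σ, 0 ≤ u σ) → LocalOn A u →
      𝔼 σ, u σ * S σ ^ 2 ≤ C * 𝔼 σ, u σ := by
    intro u hu0 hu
    have e1 : 𝔼 σ, u σ * S σ ^ 2 = ∑ k, ∑ l, 𝔼 σ, u σ * (d k σ * d l σ) := by
      simp only [← Finset.expect_sum_comm, ← Finset.mul_sum, hS, sq, Finset.sum_mul]
    have e2 : ∀ k l, k ≠ l → 𝔼 σ, u σ * (d k σ * d l σ) = 0 := by
      intro k l hkl
      have : 𝔼 σ, u σ * (d k σ * d l σ) = -𝔼 σ, u σ * (d k σ * d l σ) := by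
        conv_lhs => rw [← expect_perm (Equiv.swap (B (k, 1)) (B (k, 2)))]
        rw [← Finset.expect_neg_distrib]
        refine Finset.expect_congr rfl fun σ _ => ?_
        rw [hu _ (hfix k), hswap, hswap, if_pos rfl, if_neg hkl.symm]
        ring
      linarith
    have e3 : ∀ k, ∑ l, 𝔼 σ, u σ * (d k σ * d l σ) = 𝔼 σ, u σ * m2 σ := by
      intro k
      rw [Finset.sum_eq_single k (fun l _ h => e2 k l h.symm) (by simp)]
      exact hdd u hu0 hu k
    rw [e1, Finset.sum_congr rfl fun k _ => e3 k, Finset.sum_const, card_univ, Fintype.card_fin,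
      nsmul_eq_mul, Finset.mul_expect, Finset.mul_expect]
    refine Finset.expect_le_expect fun σ _ => ?_
    have := mul_le_mul_of_nonneg_left (hC σ) (hu0 σ)
    simp only [hm2]
    linarith
  have step2 : 𝔼 σ, w σ * (ℓ σ + 2 * δ) * |S σ| ≤
      (1 + C) / 2 * 𝔼 σ, w σ * (ℓ σ + 2 * δ) := by
    have h := hSS (fun σ => w σ * (ℓ σ + 2 * δ))
      (fun σ => mul_nonneg (hw0 σ) (by have := hℓ0 σ; positivity))
      (fun g hg σ => by simp only [hw g hg, hℓ g hg])
    calc 𝔼 σ, w σ * (ℓ σ + 2 * δ) * |S σ| ≤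
        𝔼 σ, ((w σ * (ℓ σ + 2 * δ)) * (1 / 2) + (w σ * (ℓ σ + 2 * δ) * S σ ^ 2) * (1 / 2)) := by
          refine Finset.expect_le_expect fun σ _ => ?_
          have h0 : 0 ≤ w σ * (ℓ σ + 2 * δ) :=
            mul_nonneg (hw0 σ) (by have := hℓ0 σ; positivity)
          have h1 : |S σ| ≤ 1 / 2 + S σ ^ 2 * (1 / 2) := by
            rw [← sq_abs]
            nlinarith [sq_nonneg (|S σ| - 1)]
          have := mul_le_mul_of_nonneg_left h1 h0
          linarith
      _ = (𝔼 σ, w σ * (ℓ σ + 2 * δ)) * (1 / 2) +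
          (𝔼 σ, w σ * (ℓ σ + 2 * δ) * S σ ^ 2) * (1 / 2) := by
          rw [Finset.expect_add_distrib, Finset.expect_mul, Finset.expect_mul]
      _ ≤ _ := by linarith
  -- fluctuations of the truncated quadratic variation
  have hMμ : ∀ σ, M * μ σ ≤ C := fun σ =>
    le_trans (mul_le_mul_of_nonneg_left (Finset.expect_le_expect fun s _ => hqD _)
      (Nat.cast_nonneg M)) (hC σ)
  have hμ0 : ∀ σ, 0 ≤ μ σ := fun σ => Finset.expect_nonneg fun s _ => hq0 _
  have hμloc : LocalOn A μ := localOn_expect q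
  have hvar : 𝔼 σ, w σ * (Q σ - M * μ σ) ^ 2 ≤ (δ ^ 2 * C + r * C ^ 2) * 𝔼 σ, w σ := by
    have e1 : 𝔼 σ, w σ * Q σ ^ 2 ≤ δ ^ 2 * C * (𝔼 σ, w σ) +
        (1 + r) * (M ^ 2 * 𝔼 σ, w σ * μ σ ^ 2) := by
      have hX : 0 ≤ (1 + r) * 𝔼 σ, w σ * μ σ ^ 2 :=
        mul_nonneg (by linarith) (Finset.expect_nonneg fun σ _ => mul_nonneg (hw0 σ) (sq_nonneg _))
      have hkl : ∀ k l, 𝔼 σ, w σ * (q (fun i => σ (B (k, i))) * q (fun i => σ (B (l, i)))) ≤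
          (if k = l then δ ^ 2 * 𝔼 σ, w σ * m2 σ else 0) + (1 + r) * 𝔼 σ, w σ * μ σ ^ 2 := by
        intro k l
        split_ifs with h
        · subst h
          refine le_trans ?_ (le_add_of_nonneg_right hX)
          rw [← hdd w hw0 hw k, Finset.mul_expect]
          refine Finset.expect_le_expect fun σ _ => ?_
          have := mul_le_mul_of_nonneg_left (hq2 (fun i => σ (B (k, i)))) (hw0 σ)
          refine this.trans (le_of_eq ?_)
          simp only [hd]
          ring
        · rw [zero_add]
          let t : Fin 4 ⊕ Fin 4 ↪ P := ⟨Sum.elim (b k) (b l), by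
            refine Function.Injective.sumElim (b k).injective (b l).injective ?_
            intro i j h'
            exact h (congrArg Prod.fst (B.injective h'))⟩
          exact expect_mul_tuple_mul_tuple_le hw hw0 q hq0 t
            (by rintro (i | i) <;> exact hB _) hr
      calc 𝔼 σ, w σ * Q σ ^ 2 = ∑ k, ∑ l,
            𝔼 σ, w σ * (q (fun i => σ (B (k, i))) * q (fun i => σ (B (l, i)))) := by
            simp only [← Finset.expect_sum_comm, ← Finset.mul_sum, hQ, sq, Finset.sum_mul]
        _ ≤ ∑ k : Fin M, ∑ l : Fin M, ((if k = l then δ ^ 2 * 𝔼 σ, w σ * m2 σ else 0) +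
            (1 + r) * 𝔼 σ, w σ * μ σ ^ 2) :=
            Finset.sum_le_sum fun k _ => Finset.sum_le_sum fun l _ => hkl k l
        _ = δ ^ 2 * (𝔼 σ, w σ * (M * m2 σ)) + (1 + r) * (M ^ 2 * 𝔼 σ, w σ * μ σ ^ 2) := by
            simp only [Finset.sum_add_distrib, Finset.sum_ite_eq, mem_univ, if_true,
              Finset.sum_const, card_univ, Fintype.card_fin, nsmul_eq_mul]
            have : 𝔼 σ, w σ * (M * m2 σ) = M * 𝔼 σ, w σ * m2 σ := by
              rw [Finset.mul_expect]
              exact Finset.expect_congr rfl fun σ _ => by ring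
            rw [this]
            ring
        _ ≤ _ := by
            have : 𝔼 σ, w σ * (M * m2 σ) ≤ (𝔼 σ, w σ) * C := by
              rw [Finset.expect_mul]
              exact Finset.expect_le_expect fun σ _ =>
                mul_le_mul_of_nonneg_left (hC σ) (hw0 σ)
            have := mul_le_mul_of_nonneg_left this (sq_nonneg δ)
            linarith
    have e2 : 𝔼 σ, w σ * μ σ * Q σ = M * 𝔼 σ, w σ * μ σ ^ 2 := by
      have hk : ∀ k, 𝔼 σ, w σ * μ σ * q (fun i => σ (B (k, i))) = 𝔼 σ, w σ * μ σ ^ 2 := by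
        intro k
        have := expect_mul_tuple (hw.mul hμloc) q (b k) (hbA k)
        refine Eq.trans this (Finset.expect_congr rfl fun σ _ => ?_)
        simp only [hμ]
        ring
      simp only [hQ, Finset.mul_sum, Finset.expect_sum_comm]
      rw [Finset.sum_congr rfl fun k _ => hk k, Finset.sum_const, card_univ, Fintype.card_fin,
        nsmul_eq_mul]
    have e3 : 𝔼 σ, w σ * (Q σ - M * μ σ) ^ 2 =
        𝔼 σ, w σ * Q σ ^ 2 - 2 * M * (𝔼 σ, w σ * μ σ * Q σ) + M ^ 2 * 𝔼 σ, w σ * μ σ ^ 2 := by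
      rw [Finset.mul_expect, Finset.mul_expect, ← Finset.expect_sub_distrib,
        ← Finset.expect_add_distrib]
      exact Finset.expect_congr rfl fun σ _ => by ring
    have e4 : M ^ 2 * 𝔼 σ, w σ * μ σ ^ 2 ≤ C ^ 2 * 𝔼 σ, w σ := by
      rw [Finset.mul_expect, Finset.mul_expect]
      refine Finset.expect_le_expect fun σ _ => ?_
      have h := mul_self_le_mul_self (mul_nonneg (Nat.cast_nonneg M) (hμ0 σ)) (hMμ σ)
      have := mul_le_mul_of_nonneg_left h (hw0 σ)
      nlinarith
    have e5 := mul_le_mul_of_nonneg_left e4 hr0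
    rw [e3, e2]
    nlinarith
  have hvv : 𝔼 σ, w σ * v σ ≤ 𝔼 σ, (w σ * v σ * Q σ +
      (w σ * (η / 2) + w σ * (Q σ - M * μ σ) ^ 2 * (1 / (2 * η)))) := by
    refine Finset.expect_le_expect fun σ _ => ?_
    have hwv : 0 ≤ w σ * v σ := mul_nonneg (hw0 σ) (hv0 σ)
    have h2 : M * μ σ - Q σ ≤ η / 2 + (Q σ - M * μ σ) ^ 2 * (1 / (2 * η)) := by
      have : η / 2 + (Q σ - M * μ σ) ^ 2 * (1 / (2 * η)) - (M * μ σ - Q σ) =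
          (Q σ - M * μ σ + η) ^ 2 * (1 / (2 * η)) := by
        field_simp
        ring
      have h : 0 ≤ (Q σ - M * μ σ + η) ^ 2 * (1 / (2 * η)) := by positivity
      linarith
    have h3 : w σ * v σ ≤ w σ * v σ * (M * μ σ) := le_mul_of_one_le_right hwv (h1 σ)
    have h4 := mul_le_mul_of_nonneg_left h2 hwv
    have h5 : 0 ≤ η / 2 + (Q σ - M * μ σ) ^ 2 * (1 / (2 * η)) := by positivity
    have h6 : w σ * v σ ≤ w σ := mul_le_of_le_one_right (hw0 σ) (hv1 σ)
    have h7 := mul_le_mul_of_nonneg_right h6 h5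
    linarith
  rw [Finset.expect_add_distrib, Finset.expect_add_distrib, ← Finset.expect_mul,
    ← Finset.expect_mul] at hvv
  have hfin : 𝔼 σ, w σ * ((1 + C) / 2 * (ℓ σ + 2 * δ) +
      (η / 2 + (δ ^ 2 * C + r * C ^ 2) / (2 * η))) =
      (1 + C) / 2 * (𝔼 σ, w σ * (ℓ σ + 2 * δ)) +
      (𝔼 σ, w σ) * (η / 2 + (δ ^ 2 * C + r * C ^ 2) / (2 * η)) := by
    rw [Finset.mul_expect, Finset.expect_mul, ← Finset.expect_add_distrib]
    exact Finset.expect_congr rfl fun σ _ => by ring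
  rw [hfin]
  have h8 := mul_le_mul_of_nonneg_right hvar (by positivity : 0 ≤ 1 / (2 * η))
  have h9 : (δ ^ 2 * C + r * C ^ 2) * (𝔼 σ, w σ) * (1 / (2 * η)) =
      (𝔼 σ, w σ) * ((δ ^ 2 * C + r * C ^ 2) / (2 * η)) := by
    field_simp
  linarith

end Concentration

section Moments

variable {P V : Type*} [Fintype P] [DecidableEq P] [Fintype V] [DecidableEq V]

theorem localOn_of_forall {α : Type*} {A : Finset P} {w : (P ≃ V) → α}
    (h : ∀ σ τ : P ≃ V, (∀ p ∈ A, σ p = τ p) → w σ = w τ) : LocalOn A w := fun g hg σ =>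
  h _ _ fun p hp => by simp [hg p hp]

theorem sum_compl_apply (A : Finset P) (σ : P ≃ V) (h : V → ℝ) :
    ∑ r ∈ Aᶜ, h (σ r) = ∑ v, h v - ∑ r ∈ A, h (σ r) := by
  rw [← Equiv.sum_comp σ h, ← Finset.sum_add_sum_compl A]
  ring

theorem expect_pair (hPV : Nonempty (P ≃ V)) (h : V → V → ℝ) (h0 : ∀ v, h v v = 0) {p q : P}
    (hpq : p ≠ q) :
    (Fintype.card P : ℝ) * (Fintype.card P - 1) * 𝔼 σ : P ≃ V, h (σ p) (σ q) =
      ∑ v, ∑ w, h v w := by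
  have h1 := expect_sum_out (P := P) (V := V) (A := {p}) (G := fun σ x => h (σ p) x) (p := q)
    (localOn_of_forall fun σ τ hst => by rw [hst p (by simp)]) (by simpa using hpq.symm)
  have h2 := expect_sum_out (P := P) (V := V) (A := ∅) (G := fun _ x => ∑ w, h x w) (p := p)
    (localOn_of_forall fun _ _ _ => rfl) (by simp)
  simp only [sum_compl_apply, sum_singleton, h0, sub_zero, card_singleton, Nat.cast_one] at h1
  simp only [card_empty, Nat.cast_zero, sub_zero, compl_empty] at h2
  have h3 : ∀ σ : P ≃ V, ∑ r, ∑ w, h (σ r) w = ∑ v, ∑ w, h v w := fun σ =>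
    Equiv.sum_comp σ fun v => ∑ w, h v w
  rw [mul_assoc, h1, h2, Finset.expect_congr rfl fun σ _ => h3 σ,
    Finset.expect_const (Finset.univ_nonempty_iff.2 hPV)]

theorem expect_indicator (hPV : Nonempty (P ≃ V)) (a : V) (p : P) :
    (Fintype.card P : ℝ) * 𝔼 σ : P ≃ V, (if σ p = a then (1 : ℝ) else 0) = 1 := by
  have h2 := expect_sum_out (P := P) (V := V) (A := ∅)
    (G := fun _ x => if x = a then (1 : ℝ) else 0) (p := p)
    (localOn_of_forall fun _ _ _ => rfl) (by simp)
  simp only [card_empty, Nat.cast_zero, sub_zero, compl_empty] at h2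
  have h3 : ∀ σ : P ≃ V, ∑ r, (if σ r = a then (1 : ℝ) else 0) = 1 := fun σ => by
    rw [Equiv.sum_comp σ fun v => if v = a then (1 : ℝ) else 0]
    simp
  rw [h2, Finset.expect_congr rfl fun σ _ => h3 σ,
    Finset.expect_const (Finset.univ_nonempty_iff.2 hPV)]

theorem expect_pair_mul_indicator_le (hPV : Nonempty (P ≃ V)) {h : V → V → ℝ}
    (h0 : ∀ v, h v v = 0) (hs : ∀ v w, h v w = h w v) (hp : ∀ v w, 0 ≤ h v w) {ρ : ℝ}
    (hρ : ∀ v, ∑ w, h v w ≤ ρ) (hc : 3 ≤ Fintype.card P) {p q : P} (hpq : p ≠ q) (r : P)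
    (a : V) :
    𝔼 σ : P ≃ V, h (σ p) (σ q) * (if σ r = a then 1 else 0) ≤
      ρ / ((Fintype.card P - 1) * (Fintype.card P - 2)) := by
  have hc' : (3 : ℝ) ≤ Fintype.card P := by exact_mod_cast hc
  have hρ0 : 0 ≤ ρ := (Finset.sum_nonneg fun w _ => hp a w).trans (hρ a)
  set n : ℝ := (Fintype.card P : ℝ)
  have key : ∀ p q : P, p ≠ q → 𝔼 σ : P ≃ V, h (σ p) (σ q) * (if σ p = a then 1 else 0) ≤
      ρ / ((n - 1) * (n - 2)) := by
    intro p q hpq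
    have h1 := expect_sum_out (P := P) (V := V) (A := {p})
      (G := fun σ x => h (σ p) x * (if σ p = a then 1 else 0)) (p := q)
      (localOn_of_forall fun σ τ hst => by rw [hst p (by simp)]) (by simpa using hpq.symm)
    simp only [card_singleton, Nat.cast_one, ← Finset.sum_mul] at h1
    simp only [sum_compl_apply, sum_singleton, h0, sub_zero] at h1
    have h2 : 𝔼 σ : P ≃ V, (∑ i, h (σ p) i) * (if σ p = a then 1 else 0) ≤
        ρ * 𝔼 σ : P ≃ V, (if σ p = a then (1 : ℝ) else 0) := by
      rw [Finset.mul_expect]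
      exact Finset.expect_le_expect fun σ _ => mul_le_mul_of_nonneg_right (hρ _)
        (by split_ifs <;> norm_num)
    have h3 := expect_indicator hPV a p
    rw [le_div_iff₀ (mul_pos (by linarith) (by linarith))]
    set X := 𝔼 σ : P ≃ V, h (σ p) (σ q) * (if σ p = a then 1 else 0)
    set I := 𝔼 σ : P ≃ V, (if σ p = a then (1 : ℝ) else 0)
    have hI : (n - 2) * I ≤ 1 := by
      have : 0 ≤ I := Finset.expect_nonneg fun _ _ => by split_ifs <;> norm_num
      nlinarith
    calc X * ((n - 1) * (n - 2)) = (n - 1) * X * (n - 2) := by ring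
      _ ≤ ρ * I * (n - 2) := mul_le_mul_of_nonneg_right (h1.trans_le h2) (by linarith)
      _ = ρ * ((n - 2) * I) := by ring
      _ ≤ ρ := mul_le_of_le_one_right hρ0 hI
  by_cases hrp : r = p
  · subst hrp; exact key r q hpq
  by_cases hrq : r = q
  · subst hrq
    simp only [hs (_ : V) ((_ : P ≃ V) r)]
    exact key r p hpq.symm
  have h1 := expect_sum_out (P := P) (V := V) (A := {p, q})
    (G := fun σ x => h (σ p) (σ q) * (if x = a then 1 else 0)) (p := r)
    (localOn_of_forall fun σ τ hst => by rw [hst p (by simp), hst q (by simp)])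
    (by simp [hrp, hrq])
  rw [card_pair hpq] at h1
  have h2 := expect_pair hPV h h0 hpq
  have h3 : ∑ v, ∑ w, h v w ≤ n * ρ := by
    calc ∑ v, ∑ w, h v w ≤ ∑ v : V, ρ := Finset.sum_le_sum fun v _ => hρ v
      _ = n * ρ := by
        rw [Finset.sum_const, card_univ, nsmul_eq_mul, ← Fintype.card_congr hPV.some]
  have h4 : 𝔼 σ : P ≃ V, ∑ r ∈ ({p, q} : Finset P)ᶜ,
      h (σ p) (σ q) * (if σ r = a then 1 else 0) ≤ 𝔼 σ : P ≃ V, h (σ p) (σ q) := by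
    refine Finset.expect_le_expect fun σ _ => ?_
    rw [← Finset.mul_sum]
    refine mul_le_of_le_one_right (hp _ _) ?_
    calc _ ≤ ∑ r, (if σ r = a then (1 : ℝ) else 0) :=
          Finset.sum_le_sum_of_subset_of_nonneg (Finset.subset_univ _) fun _ _ _ => by
            split_ifs <;> norm_num
      _ = 1 := by
          rw [Equiv.sum_comp σ fun v => if v = a then (1 : ℝ) else 0]
          simp
  rw [le_div_iff₀ (mul_pos (by linarith) (by linarith))]
  set X := 𝔼 σ : P ≃ V, h (σ p) (σ q) * (if σ r = a then 1 else 0)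
  set Y := 𝔼 σ : P ≃ V, h (σ p) (σ q)
  have h5 : (n - 1) * Y ≤ ρ := by
    have : n * ((n - 1) * Y) ≤ n * ρ := by linarith
    exact le_of_mul_le_mul_left this (by linarith)
  have h6 : (n - 2) * X ≤ Y := by
    have := h1.trans_le h4
    push_cast at this
    exact this
  nlinarith

end Moments

section Array

variable {P V : Type*} [Fintype P] [DecidableEq P] [Fintype V] [DecidableEq V]

/-- A normalised symmetric array with zero row sums and small third moments. -/
structure IsArr (e : V → V → ℝ) (ε : ℝ) : Prop where
  symm : ∀ v w, e v w = e w v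
  diag : ∀ v, e v v = 0
  row : ∀ v, ∑ w, e v w = 0
  sq_sum : ∑ v, ∑ w, e v w ^ 2 =
    ((Fintype.card V : ℝ) - 1) * (Fintype.card V - 3) / (2 * (Fintype.card V - 2))
  cube_sum : ∑ v, ∑ w, |e v w| ^ 3 ≤ Fintype.card V * ε
  row_sq : ∀ v, ∑ w, e v w ^ 2 ≤ Fintype.card V * (14 / 100000)
  large : 1000000 ≤ (Fintype.card V : ℝ)
  pos : 0 < ε
  inv_le : 1 ≤ 70 * ε ^ 2 * Fintype.card V

/-- Twice the change of the matching sum when the matching `01|23` is replaced by `02|13`. -/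
def quadDiff (e : V → V → ℝ) (x : Fin 4 → V) : ℝ :=
  2 * (e (x 0) (x 2) + e (x 1) (x 3) - e (x 0) (x 1) - e (x 2) (x 3))

/-- The sum of `h` over the four edges entering `quadDiff`. -/
def quadSum (h : V → V → ℝ) (x : Fin 4 → V) : ℝ :=
  h (x 0) (x 2) + h (x 1) (x 3) + h (x 0) (x 1) + h (x 2) (x 3)

theorem quadDiff_swap (e : V → V → ℝ) (x : Fin 4 → V) :
    quadDiff e (fun i => x (Equiv.swap 1 2 i)) = -quadDiff e x := by
  have h0 : Equiv.swap (1 : Fin 4) 2 0 = 0 := by decide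
  have h1 : Equiv.swap (1 : Fin 4) 2 1 = 2 := by decide
  have h2 : Equiv.swap (1 : Fin 4) 2 2 = 1 := by decide
  have h3 : Equiv.swap (1 : Fin 4) 2 3 = 3 := by decide
  simp only [quadDiff, h0, h1, h2, h3]
  ring

theorem abs_quadDiff_le (e : V → V → ℝ) (x : Fin 4 → V) :
    |quadDiff e x| ≤ 2 * quadSum (fun v w => |e v w|) x := by
  unfold quadDiff quadSum
  rw [abs_mul, abs_two]
  have h1 := abs_sub (e (x 0) (x 2) + e (x 1) (x 3) - e (x 0) (x 1)) (e (x 2) (x 3))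
  have h2 := abs_sub (e (x 0) (x 2) + e (x 1) (x 3)) (e (x 0) (x 1))
  have h3 := abs_add_le (e (x 0) (x 2)) (e (x 1) (x 3))
  linarith

theorem sq_quadDiff_le (e : V → V → ℝ) (x : Fin 4 → V) :
    quadDiff e x ^ 2 ≤ 16 * quadSum (fun v w => e v w ^ 2) x := by
  unfold quadDiff quadSum
  set a := e (x 0) (x 2)
  set b := e (x 1) (x 3)
  set c := e (x 0) (x 1)
  set d := e (x 2) (x 3)
  nlinarith [sq_nonneg (a - b), sq_nonneg (a + c), sq_nonneg (a + d), sq_nonneg (b + c),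
    sq_nonneg (b + d), sq_nonneg (c - d)]

theorem abs_quadDiff_cube_le (e : V → V → ℝ) (x : Fin 4 → V) :
    |quadDiff e x| ^ 3 ≤ 128 * quadSum (fun v w => |e v w| ^ 3) x := by
  refine (pow_le_pow_left₀ (abs_nonneg _) (abs_quadDiff_le e x) 3).trans ?_
  unfold quadSum
  have ha := abs_nonneg (e (x 0) (x 2))
  have hb := abs_nonneg (e (x 1) (x 3))
  have hc := abs_nonneg (e (x 0) (x 1))
  have hd := abs_nonneg (e (x 2) (x 3))
  have h1 := add_pow_le ha hb 3
  have h2 := add_pow_le hc hd 3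
  have h3 := add_pow_le (add_nonneg ha hb) (add_nonneg hc hd) 3
  rw [mul_pow, add_assoc (_ + _) |e (x 0) (x 1)|]
  norm_num at h1 h2 h3 ⊢
  linarith

variable {e : V → V → ℝ} {ε : ℝ}

theorem card_eq (hPV : Nonempty (P ≃ V)) : (Fintype.card P : ℝ) = Fintype.card V := by
  rw [Fintype.card_congr hPV.some]

theorem IsArr.expect_sq (he : IsArr e ε) (hPV : Nonempty (P ≃ V)) {p q : P} (hpq : p ≠ q) :
    𝔼 σ : P ≃ V, e (σ p) (σ q) ^ 2 =
      ((Fintype.card V : ℝ) - 3) / (2 * Fintype.card V * (Fintype.card V - 2)) := by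
  have h := expect_pair hPV (fun v w => e v w ^ 2) (fun v => by simp [he.diag]) hpq
  have hl := he.large
  rw [he.sq_sum, card_eq hPV] at h
  have h1 : (Fintype.card V : ℝ) - 1 ≠ 0 := by linarith
  have h2 : (Fintype.card V : ℝ) - 2 ≠ 0 := by linarith
  have h3 : (Fintype.card V : ℝ) ≠ 0 := by linarith
  field_simp at h ⊢
  linarith

theorem IsArr.expect_cube_le (he : IsArr e ε) (hPV : Nonempty (P ≃ V)) {p q : P} (hpq : p ≠ q) :
    𝔼 σ : P ≃ V, |e (σ p) (σ q)| ^ 3 ≤ ε / (Fintype.card V - 1) := by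
  have h := expect_pair hPV (fun v w => |e v w| ^ 3) (fun v => by simp [he.diag]) hpq
  have hl := he.large
  have hc := he.cube_sum
  rw [← h, card_eq hPV, mul_assoc] at hc
  rw [le_div_iff₀ (by linarith)]
  have := le_of_mul_le_mul_left hc (by linarith)
  linarith

theorem IsArr.expect_adj (he : IsArr e ε) (hPV : Nonempty (P ≃ V)) {p q r : P} (hpq : p ≠ q)
    (hpr : p ≠ r) (hqr : q ≠ r) :
    ((Fintype.card V : ℝ) - 2) * 𝔼 σ : P ≃ V, e (σ p) (σ q) * e (σ p) (σ r) =
      -𝔼 σ : P ≃ V, e (σ p) (σ q) ^ 2 := by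
  have h1 := expect_sum_out (P := P) (V := V) (A := {p, q})
    (G := fun σ x => e (σ p) (σ q) * e (σ p) x) (p := r)
    (localOn_of_forall fun σ τ hst => by rw [hst p (by simp), hst q (by simp)])
    (by simp [hpr.symm, hqr.symm])
  rw [card_pair hpq, card_eq hPV] at h1
  simp only [← Finset.mul_sum, sum_compl_apply, he.row, sum_pair hpq, he.diag] at h1
  push_cast at h1
  rw [h1, ← Finset.expect_neg_distrib]
  exact Finset.expect_congr rfl fun σ _ => by ring

theorem IsArr.expect_disj (he : IsArr e ε) (hPV : Nonempty (P ≃ V)) {p q r s : P} (hpq : p ≠ q)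
    (hpr : p ≠ r) (hqr : q ≠ r) (hps : p ≠ s) (hqs : q ≠ s) (hrs : r ≠ s) :
    ((Fintype.card V : ℝ) - 3) * 𝔼 σ : P ≃ V, e (σ p) (σ q) * e (σ r) (σ s) =
      -(𝔼 σ : P ≃ V, e (σ p) (σ q) * e (σ p) (σ r)) -
        𝔼 σ : P ≃ V, e (σ q) (σ p) * e (σ q) (σ r) := by
  have h1 := expect_sum_out (P := P) (V := V) (A := {p, q, r})
    (G := fun σ x => e (σ p) (σ q) * e (σ r) x) (p := s)
    (localOn_of_forall fun σ τ hst => by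
      rw [hst p (by simp), hst q (by simp), hst r (by simp)])
    (by simp [hps.symm, hqs.symm, hrs.symm])
  rw [card_eq_three.2 ⟨p, q, r, hpq, hpr, hqr, rfl⟩, card_eq hPV] at h1
  have hpA : p ∉ ({q, r} : Finset P) := by simp [hpq, hpr]
  simp only [← Finset.mul_sum, sum_compl_apply, he.row, sum_insert hpA, sum_pair hqr,
    he.diag] at h1
  push_cast at h1
  rw [h1, ← Finset.expect_neg_distrib, ← Finset.expect_sub_distrib]
  refine Finset.expect_congr rfl fun σ _ => ?_
  rw [he.symm (σ r) (σ p), he.symm (σ r) (σ q), he.symm (σ q) (σ p)]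
  ring

theorem IsArr.expect_sq_quadDiff (he : IsArr e ε) (t : Fin 4 ↪ P) (hPV : Nonempty (P ≃ V)) :
    𝔼 σ : P ≃ V, quadDiff e (fun i => σ (t i)) ^ 2 =
      8 * (Fintype.card V - 1) / (Fintype.card V * (Fintype.card V - 2)) := by
  have hl := he.large
  have hne : ∀ i j : Fin 4, i ≠ j → t i ≠ t j := fun i j h h' => h (t.injective h')
  set n : ℝ := (Fintype.card V : ℝ)
  set m : ℝ := (n - 3) / (2 * n * (n - 2)) with hm
  have h1 : n - 2 ≠ 0 := by linarith
  have h2 : n - 3 ≠ 0 := by linarith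
  have h3 : n ≠ 0 := by linarith
  have hsq : ∀ i j : Fin 4, i ≠ j → 𝔼 σ : P ≃ V, e (σ (t i)) (σ (t j)) ^ 2 = m :=
    fun i j h => he.expect_sq hPV (hne i j h)
  have hadj : ∀ i j k : Fin 4, i ≠ j → i ≠ k → j ≠ k →
      𝔼 σ : P ≃ V, e (σ (t i)) (σ (t j)) * e (σ (t i)) (σ (t k)) = -m / (n - 2) := by
    intro i j k hij hik hjk
    have h := he.expect_adj hPV (hne i j hij) (hne i k hik) (hne j k hjk)
    rw [hsq i j hij] at h
    rw [eq_div_iff h1, ← h]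
    ring
  have hdisj : ∀ i j k l : Fin 4, i ≠ j → i ≠ k → j ≠ k → i ≠ l → j ≠ l → k ≠ l →
      𝔼 σ : P ≃ V, e (σ (t i)) (σ (t j)) * e (σ (t k)) (σ (t l)) =
        2 * m / ((n - 2) * (n - 3)) := by
    intro i j k l hij hik hjk hil hjl hkl
    have h := he.expect_disj hPV (hne i j hij) (hne i k hik) (hne j k hjk) (hne i l hil)
      (hne j l hjl) (hne k l hkl)
    rw [hadj i j k hij hik hjk, hadj j i k hij.symm hjk hik] at h
    rw [eq_div_iff (mul_ne_zero h1 h2)]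
    field_simp at h
    linarith
  have hexp : ∀ σ : P ≃ V, quadDiff e (fun i => σ (t i)) ^ 2 =
      4 * (e (σ (t 0)) (σ (t 2)) ^ 2 + e (σ (t 1)) (σ (t 3)) ^ 2 + e (σ (t 0)) (σ (t 1)) ^ 2 +
        e (σ (t 2)) (σ (t 3)) ^ 2) +
      8 * (e (σ (t 0)) (σ (t 2)) * e (σ (t 1)) (σ (t 3)) +
        e (σ (t 0)) (σ (t 1)) * e (σ (t 2)) (σ (t 3))) -
      8 * (e (σ (t 0)) (σ (t 2)) * e (σ (t 0)) (σ (t 1)) +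
        e (σ (t 2)) (σ (t 0)) * e (σ (t 2)) (σ (t 3)) +
        e (σ (t 1)) (σ (t 3)) * e (σ (t 1)) (σ (t 0)) +
        e (σ (t 3)) (σ (t 1)) * e (σ (t 3)) (σ (t 2))) := by
    intro σ
    rw [he.symm (σ (t 2)) (σ (t 0)), he.symm (σ (t 1)) (σ (t 0)), he.symm (σ (t 3)) (σ (t 1)),
      he.symm (σ (t 3)) (σ (t 2))]
    unfold quadDiff
    ring
  simp only [hexp, Finset.expect_sub_distrib, Finset.expect_add_distrib, ← Finset.mul_expect]
  rw [hsq 0 2 (by decide), hsq 1 3 (by decide), hsq 0 1 (by decide), hsq 2 3 (by decide),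
    hdisj 0 2 1 3 (by decide) (by decide) (by decide) (by decide) (by decide) (by decide),
    hdisj 0 1 2 3 (by decide) (by decide) (by decide) (by decide) (by decide) (by decide),
    hadj 0 2 1 (by decide) (by decide) (by decide), hadj 2 0 3 (by decide) (by decide) (by decide),
    hadj 1 3 0 (by decide) (by decide) (by decide), hadj 3 1 2 (by decide) (by decide) (by decide),
    hm]
  field_simp
  ring

theorem IsArr.expect_cube_quadDiff_le (he : IsArr e ε) (t : Fin 4 ↪ P)
    (hPV : Nonempty (P ≃ V)) :
    𝔼 σ : P ≃ V, |quadDiff e (fun i => σ (t i))| ^ 3 ≤ 512 * (ε / (Fintype.card V - 1)) := by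
  have hne : ∀ i j : Fin 4, i ≠ j → t i ≠ t j := fun i j h h' => h (t.injective h')
  have h := Finset.expect_le_expect (s := (univ : Finset (P ≃ V))) fun σ _ =>
    abs_quadDiff_cube_le e (fun i => σ (t i))
  simp only [quadSum, ← Finset.mul_expect, Finset.expect_add_distrib] at h
  have h1 := he.expect_cube_le hPV (hne 0 2 (by decide))
  have h2 := he.expect_cube_le hPV (hne 1 3 (by decide))
  have h3 := he.expect_cube_le hPV (hne 0 1 (by decide))
  have h4 := he.expect_cube_le hPV (hne 2 3 (by decide))
  linarith

theorem IsArr.expect_sq_quadDiff_mul_indicator_le (he : IsArr e ε) (t : Fin 4 ↪ P)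
    (hPV : Nonempty (P ≃ V)) (r : P) (a : V) :
    𝔼 σ : P ≃ V, quadDiff e (fun i => σ (t i)) ^ 2 * (if σ r = a then (1 : ℝ) else 0) ≤
      64 * ((Fintype.card V : ℝ) * (14 / 100000) /
        ((Fintype.card V - 1) * (Fintype.card V - 2))) := by
  have hne : ∀ i j : Fin 4, i ≠ j → t i ≠ t j := fun i j h h' => h (t.injective h')
  have hl := he.large
  have hc : 3 ≤ Fintype.card P := by
    have : (3 : ℝ) ≤ Fintype.card P := by rw [card_eq hPV]; linarith
    exact_mod_cast this
  have h := Finset.expect_le_expect (s := (univ : Finset (P ≃ V))) fun σ _ =>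
    mul_le_mul_of_nonneg_right (sq_quadDiff_le e (fun i => σ (t i)))
      (by split_ifs <;> norm_num : (0 : ℝ) ≤ if σ r = a then 1 else 0)
  simp only [quadSum, mul_assoc, ← Finset.mul_expect, add_mul, Finset.expect_add_distrib] at h
  have key : ∀ i j : Fin 4, i ≠ j → _ := fun i j hij =>
    expect_pair_mul_indicator_le hPV (h := fun v w => e v w ^ 2) (fun v => by simp [he.diag])
    (fun v w => by rw [he.symm]) (fun v w => sq_nonneg _) he.row_sq hc (hne i j hij) r a
  rw [card_eq hPV] at key
  have h1 := key 0 2 (by decide)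
  have h2 := key 1 3 (by decide)
  have h3 := key 0 1 (by decide)
  have h4 := key 2 3 (by decide)
  linarith

end Array

section TupleAverage

variable {P V κ : Type*} [Fintype P] [DecidableEq P] [Fintype V] [DecidableEq V]
  [Fintype κ] [DecidableEq κ]

/-- Averaging a tuple of labels over random labellings is averaging over injective tuples. -/
theorem card_mul_expect_tuple (hPV : Nonempty (P ≃ V)) (h : (κ → V) → ℝ) (t : κ ↪ P) :
    (Fintype.card (κ ↪ P) : ℝ) * 𝔼 σ : P ≃ V, h (fun i => σ (t i)) =
      ∑ x : κ ↪ V, h (fun i => x i) := by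
  have h1 := expect_tuple_eq_expect (P := P) (V := V) (A := ∅) (G := fun _ x => h x)
    (localOn_of_forall fun _ _ _ => rfl) t (by simp)
  have h2 : ∀ σ : P ≃ V, 𝔼 s : κ ↪ {p : P // p ∉ (∅ : Finset P)}, h (fun i => σ (s i)) =
      𝔼 x : κ ↪ V, h (fun i => x i) := fun σ =>
    Fintype.expect_equiv (Equiv.embeddingCongr (Equiv.refl κ)
      ((Equiv.subtypeUnivEquiv (by simp)).trans σ)) _ _ fun s => by
        simp [Equiv.embeddingCongr]
  have h3 : Fintype.card (κ ↪ P) = Fintype.card (κ ↪ V) :=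
    Fintype.card_congr (Equiv.embeddingCongr (Equiv.refl κ) hPV.some)
  rw [h1, Finset.expect_congr rfl fun σ _ => h2 σ,
    Finset.expect_const (Finset.univ_nonempty_iff.2 hPV), h3, Fintype.card_mul_expect]

/-- The labels of a tuple of positions off `A`. -/
def labelTuple (A : Finset P) (σ : P ≃ V) : (κ ↪ {p // p ∉ A}) ↪ (κ ↪ V) :=
  ⟨fun s => (s.trans (Function.Embedding.subtype _)).trans σ.toEmbedding, fun s s' h => by
    refine DFunLike.ext _ _ fun i => Subtype.ext (σ.injective ?_)
    simpa using DFunLike.congr_fun h i⟩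

theorem card_mul_expect_tuple_off_le (h : (κ → V) → ℝ) (hh : ∀ x, 0 ≤ h x) (A : Finset P)
    (σ : P ≃ V) (t : κ ↪ P) :
    (Fintype.card (κ ↪ {p // p ∉ A}) : ℝ) *
        𝔼 s : κ ↪ {p // p ∉ A}, h (fun i => σ (s i)) ≤
      (Fintype.card (κ ↪ P) : ℝ) * 𝔼 σ : P ≃ V, h (fun i => σ (t i)) := by
  rw [Fintype.card_mul_expect, card_mul_expect_tuple ⟨σ⟩]
  have := Finset.sum_map univ (labelTuple (κ := κ) A σ) fun x => h (fun i => x i)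
  refine le_trans (le_of_eq ?_) (Finset.sum_le_sum_of_subset_of_nonneg
    (Finset.subset_univ (univ.map (labelTuple A σ))) fun _ _ _ => hh _)
  rw [this]
  rfl

theorem le_card_mul_expect_tuple_off (h : (κ → V) → ℝ) (hh : ∀ x, 0 ≤ h x) (A : Finset P)
    (σ : P ≃ V) (t : κ ↪ P) :
    (Fintype.card (κ ↪ P) : ℝ) * (𝔼 σ : P ≃ V, h (fun i => σ (t i)) -
        ∑ a ∈ A, ∑ i, 𝔼 τ : P ≃ V, h (fun i => τ (t i)) * (if τ (t i) = σ a then (1 : ℝ) else 0)) ≤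
      (Fintype.card (κ ↪ {p // p ∉ A}) : ℝ) *
        𝔼 s : κ ↪ {p // p ∉ A}, h (fun i => σ (s i)) := by
  rw [Fintype.card_mul_expect, mul_sub, card_mul_expect_tuple ⟨σ⟩, Finset.mul_sum]
  simp only [Finset.mul_sum]
  have h1 : ∀ a i, (Fintype.card (κ ↪ P) : ℝ) * 𝔼 τ : P ≃ V, h (fun i => τ (t i)) *
      (if τ (t i) = σ a then (1 : ℝ) else 0) =
      ∑ x : κ ↪ V, h (fun i => x i) * (if x i = σ a then 1 else 0) := fun a i =>
    card_mul_expect_tuple ⟨σ⟩ (fun x => h x * (if x i = σ a then 1 else 0)) t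
  simp only [h1]
  have h2 := Finset.sum_map univ (labelTuple (κ := κ) A σ) fun x => h (fun i => x i)
  have h3 : ∑ s : κ ↪ {p // p ∉ A}, h (fun i => σ (s i)) =
      ∑ x ∈ univ.map (labelTuple (κ := κ) A σ), h (fun i => x i) := by
    rw [h2]
    rfl
  rw [h3, sub_le_iff_le_add, ← Finset.sum_add_sum_compl (univ.map (labelTuple (κ := κ) A σ))]
  refine add_le_add le_rfl ?_
  simp only [Finset.sum_comm (s := (univ : Finset κ))]
  rw [Finset.sum_comm]
  refine (Finset.sum_le_sum fun x hx => ?_).trans (Finset.sum_le_sum_of_subset_of_nonneg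
    (Finset.subset_univ _) fun x _ _ => Finset.sum_nonneg fun a _ => Finset.sum_nonneg fun i _ =>
      mul_nonneg (hh _) (by split_ifs <;> norm_num))
  have hex : ∃ a ∈ A, ∃ i, x i = σ a := by
    by_contra! hcon
    refine (Finset.mem_compl.1 hx) (Finset.mem_map.2 ⟨⟨fun i => ⟨σ.symm (x i), fun hi =>
      hcon _ hi i (by simp)⟩, fun i j hij => x.injective (by simpa using hij)⟩, by simp, ?_⟩)
    refine DFunLike.ext _ _ fun i => ?_
    exact σ.apply_symm_apply (x i)
  obtain ⟨a, ha, i, hi⟩ := hex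
  have hnn : ∀ a i, 0 ≤ h (fun i => x i) * (if x i = σ a then (1 : ℝ) else 0) := fun a i =>
    mul_nonneg (hh _) (by split_ifs <;> norm_num)
  calc h (fun i => x i) = h (fun i => x i) * (if x i = σ a then (1 : ℝ) else 0) := by
        rw [if_pos hi, mul_one]
    _ ≤ ∑ i, h (fun i => x i) * (if x i = σ a then (1 : ℝ) else 0) :=
        Finset.single_le_sum (f := fun i => h (fun i => x i) * (if x i = σ a then (1 : ℝ) else 0))
          (fun i _ => hnn a i) (Finset.mem_univ i)
    _ ≤ _ := Finset.single_le_sum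
          (f := fun a => ∑ i, h (fun i => x i) * (if x i = σ a then (1 : ℝ) else 0))
          (fun a _ => Finset.sum_nonneg fun i _ => hnn a i) ha

end TupleAverage

section ArrayConcentration

variable {P V : Type*} [Fintype P] [DecidableEq P] [Fintype V] [DecidableEq V]

theorem card_embedding_four (Q : Type*) [Fintype Q] [DecidableEq Q] (h : 3 ≤ Fintype.card Q) :
    (Fintype.card (Fin 4 ↪ Q) : ℝ) = Fintype.card Q * (Fintype.card Q - 1) *
      (Fintype.card Q - 2) * (Fintype.card Q - 3) := by
  rw [Fintype.card_embedding_eq, Fintype.card_fin]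
  obtain ⟨k, hk⟩ := Nat.exists_eq_add_of_le h
  rw [hk]
  simp [Nat.descFactorial, show 3 + k - 1 = k + 2 by omega,
    show 3 + k - 2 = k + 1 by omega]
  ring

theorem card_embedding_eight (Q : Type*) [Fintype Q] [DecidableEq Q] (h : 7 ≤ Fintype.card Q) :
    (Fintype.card (Fin 4 ⊕ Fin 4 ↪ Q) : ℝ) = Fintype.card Q * (Fintype.card Q - 1) *
      (Fintype.card Q - 2) * (Fintype.card Q - 3) * ((Fintype.card Q - 4) *
      (Fintype.card Q - 5) * (Fintype.card Q - 6) * (Fintype.card Q - 7)) := by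
  rw [Fintype.card_embedding_eq, Fintype.card_sum, Fintype.card_fin]
  obtain ⟨k, hk⟩ := Nat.exists_eq_add_of_le h
  rw [hk]
  simp [Nat.descFactorial, show 7 + k - 1 = k + 6 by omega,
    show 7 + k - 2 = k + 5 by omega, show 7 + k - 3 = k + 4 by omega,
    show 7 + k - 4 = k + 3 by omega, show 7 + k - 5 = k + 2 by omega,
    show 7 + k - 6 = k + 1 by omega]
  ring

theorem mul_four_le_mul_four {a b c d a' b' c' d' k : ℝ} (ha : 0 ≤ a) (hb : 0 ≤ b)
    (hc : 0 ≤ c) (hd : 0 ≤ d) (ha' : a ≤ k * a') (hb' : b ≤ k * b') (hc' : c ≤ k * c')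
    (hd' : d ≤ k * d') : a * b * c * d ≤ k ^ 4 * (a' * b' * c' * d') := by
  calc a * b * c * d ≤ k * a' * (k * b') * (k * c') * (k * d') := by
        have h1 := ha.trans ha'
        have h2 := hb.trans hb'
        have h3 := hc.trans hc'
        gcongr
    _ = _ := by ring

theorem sq_sub_le_mul_min (x : ℝ) {δ : ℝ} (hδ : 0 < δ) :
    x ^ 2 - |x| ^ 3 / (4 * δ) ≤ |x| * min |x| δ := by
  have h0 := abs_nonneg x
  rcases le_total |x| δ with h | h
  · rw [min_eq_left h, ← sq_abs]
    have : 0 ≤ |x| ^ 3 / (4 * δ) := by positivity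
    nlinarith
  · rw [min_eq_right h, ← sq_abs]
    have : |x| * δ - (|x| ^ 2 - |x| ^ 3 / (4 * δ)) = |x| * (|x| - 2 * δ) ^ 2 / (4 * δ) := by
      field_simp
      ring
    have : 0 ≤ |x| * (|x| - 2 * δ) ^ 2 / (4 * δ) := by positivity
    linarith

variable {e : V → V → ℝ} {ε : ℝ}

set_option maxHeartbeats 1000000 in
/-- Anti-concentration for a matching statistic, given the labels in at most `12` positions. -/
theorem IsArr.concentration (he : IsArr e ε) {M : ℕ} {A : Finset P} (hA : #A ≤ 12)
    (hM : 4 * (M : ℝ) ≤ Fintype.card V) (hM' : (Fintype.card V : ℝ) ≤ 4 * M + 20)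
    (B : Fin M × Fin 4 ↪ P) (hB : ∀ x, B x ∉ A)
    {w ℓ Z : (P ≃ V) → ℝ} (hw0 : ∀ σ, 0 ≤ w σ) (hℓ0 : ∀ σ, 0 ≤ ℓ σ) (hw : LocalOn A w)
    (hℓ : LocalOn A ℓ)
    (hZ : ∀ k σ, Z ((Equiv.swap (B (k, 1)) (B (k, 2))).trans σ) =
      Z σ + quadDiff e (fun i => σ (B (k, i)))) :
    𝔼 σ, w σ * (if 0 ≤ Z σ ∧ Z σ ≤ ℓ σ then 1 else 0) ≤
      𝔼 σ, w σ * (2 * ℓ σ + 500 * ε) := by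
  have hl := he.large
  have hε := he.pos
  have hinv := he.inv_le
  rcases isEmpty_or_nonempty (P ≃ V) with hPV | hPV
  · simp
  have hP := card_eq hPV
  set n : ℝ := (Fintype.card V : ℝ)
  have hM0 : 0 < M := by
    have : (0 : ℝ) < M := by linarith
    exact_mod_cast this
  let t : Fin 4 ↪ P := ⟨fun i => B (⟨0, hM0⟩, i), fun i j h => by simpa using B.injective h⟩
  obtain ⟨m, hm⟩ : ∃ m : ℝ, (Fintype.card {p // p ∉ A} : ℝ) = m := ⟨_, rfl⟩
  have hm1 : n - 12 ≤ m ∧ m ≤ n := by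
    have h1 : Fintype.card {p // p ∉ A} = Fintype.card P - #A := by
      rw [Fintype.card_subtype_compl, Fintype.card_coe]
    have h2 := Finset.card_le_univ A
    have h3 : (#A : ℝ) ≤ 12 := by exact_mod_cast hA
    rw [← hm, h1, Nat.cast_sub h2, hP]
    exact ⟨by linarith, by simp⟩
  obtain ⟨hm1, hm2⟩ := hm1
  have hN4 := card_embedding_four P (by
    have : (3 : ℝ) ≤ Fintype.card P := by rw [hP]; linarith
    exact_mod_cast this)
  have hN4' := card_embedding_four {p // p ∉ A} (by
    have : (3 : ℝ) ≤ Fintype.card {p // p ∉ A} := by rw [hm]; linarith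
    exact_mod_cast this)
  have hN8' := card_embedding_eight {p // p ∉ A} (by
    have : (7 : ℝ) ≤ Fintype.card {p // p ∉ A} := by rw [hm]; linarith
    exact_mod_cast this)
  rw [hP] at hN4
  rw [hm] at hN4' hN8'
  have hpos' : 0 < m * (m - 1) * (m - 2) * (m - 3) := by
    have h1 : 0 < m - 1 := by linarith
    have h2 : 0 < m - 2 := by linarith
    have h3 : 0 < m - 3 := by linarith
    have h4 : 0 < m := by linarith
    positivity
  have hpos : 0 < n * (n - 1) * (n - 2) * (n - 3) := by
    have h1 : 0 < n - 1 := by linarith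
    have h2 : 0 < n - 2 := by linarith
    have h3 : 0 < n - 3 := by linarith
    have h4 : 0 < n := by linarith
    positivity
  have hcmp : n * (n - 1) * (n - 2) * (n - 3) ≤ 1.001 * (m * (m - 1) * (m - 2) * (m - 3)) := by
    have h := mul_four_le_mul_four (a := n) (b := n - 1) (c := n - 2) (d := n - 3) (a' := m)
      (b' := m - 1) (c' := m - 2) (d' := m - 3) (k := 1.0002) (by linarith)
      (by linarith) (by linarith) (by linarith) (by linarith) (by linarith) (by linarith)
      (by linarith)
    refine h.trans (mul_le_mul_of_nonneg_right (by norm_num) hpos'.le)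
  have hcmp' : m * (m - 1) * (m - 2) * (m - 3) ≤ n * (n - 1) * (n - 2) * (n - 3) := by
    have h := mul_four_le_mul_four (a := m) (b := m - 1) (c := m - 2) (d := m - 3) (a' := n)
      (b' := n - 1) (c' := n - 2) (d' := n - 3) (k := 1) (by linarith)
      (by linarith) (by linarith) (by linarith) (by linarith) (by linarith) (by linarith)
      (by linarith)
    linarith
  have hratio : (Fintype.card (Fin 4 ↪ {p // p ∉ A}) : ℝ) ^ 2 ≤
      (1 + 100 / n) * Fintype.card (Fin 4 ⊕ Fin 4 ↪ {p // p ∉ A}) := by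
    have hn0 : 0 < n := by linarith
    have hy : 5 / n ≤ 1 / 100 := by
      rw [div_le_div_iff₀ hn0 (by norm_num)]
      linarith
    have hy0 : 0 < 5 / n := by positivity
    have hyn : 5 / n * n = 5 := div_mul_cancel₀ _ hn0.ne'
    have key : ∀ x, n - 15 ≤ x → x ≤ (1 + 5 / n) * (x - 4) := by
      intro x hx
      have : 5 / n * (n - 19) ≤ 5 / n * (x - 4) := mul_le_mul_of_nonneg_left (by linarith) hy0.le
      linarith
    have h := mul_four_le_mul_four (a := m) (b := m - 1) (c := m - 2) (d := m - 3) (a' := m - 4)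
      (b' := m - 1 - 4) (c' := m - 2 - 4) (d' := m - 3 - 4) (k := 1 + 5 / n)
      (by linarith) (by linarith) (by linarith) (by linarith) (key _ (by linarith))
      (key _ (by linarith)) (key _ (by linarith)) (key _ (by linarith))
    have hk : (1 + 5 / n) ^ 4 ≤ 1 + 100 / n := by
      have : 100 / n = 20 * (5 / n) := by ring
      rw [this]
      nlinarith [mul_nonneg hy0.le hy0.le, pow_nonneg hy0.le 3, pow_nonneg hy0.le 4,
        mul_nonneg (pow_nonneg hy0.le 2) hy0.le,
        mul_le_mul_of_nonneg_left hy hy0.le, mul_le_mul_of_nonneg_left hy (pow_nonneg hy0.le 2),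
        mul_le_mul_of_nonneg_left hy (pow_nonneg hy0.le 3)]
    have hQ : 0 ≤ (m - 4) * (m - 1 - 4) * (m - 2 - 4) * (m - 3 - 4) := by
      have h1 : 0 ≤ m - 4 := by linarith
      have h2 : 0 ≤ m - 1 - 4 := by linarith
      have h3 : 0 ≤ m - 2 - 4 := by linarith
      have h4 : 0 ≤ m - 3 - 4 := by linarith
      positivity
    have h' := mul_le_mul_of_nonneg_left (h.trans (mul_le_mul_of_nonneg_right hk hQ)) hpos'.le
    rw [hN4', hN8', sq]
    refine h'.trans (le_of_eq ?_)
    ring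
  have hsq := he.expect_sq_quadDiff t hPV
  have hcube := he.expect_cube_quadDiff_le t hPV
  have hupper : ∀ σ : P ≃ V, M * 𝔼 s : Fin 4 ↪ {p // p ∉ A},
      quadDiff e (fun i => σ (s i)) ^ 2 ≤ 2.03 := by
    intro σ
    have h1 := card_mul_expect_tuple_off_le (fun x => quadDiff e x ^ 2) (fun x => sq_nonneg _) A σ t
    rw [hN4, hN4', hsq] at h1
    set X := 𝔼 s : Fin 4 ↪ {p // p ∉ A}, quadDiff e (fun i => σ (s i)) ^ 2
    have hX : X ≤ 1.001 * (8 * (n - 1) / (n * (n - 2))) := by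
      have h2 : 0 ≤ 8 * (n - 1) / (n * (n - 2)) :=
        div_nonneg (by linarith) (mul_nonneg (by linarith) (by linarith))
      have h3 := h1.trans (mul_le_mul_of_nonneg_right hcmp h2)
      refine le_of_mul_le_mul_left (h3.trans (le_of_eq ?_)) hpos'
      ring
    have hX0 : 0 ≤ X := Finset.expect_nonneg fun s _ => sq_nonneg _
    have h4 : n * (8 * (n - 1) / (n * (n - 2))) ≤ 8.08 := by
      have hn2 : 0 < n - 2 := by linarith
      rw [mul_div_assoc', mul_div_mul_left _ _ (by linarith), div_le_iff₀ hn2]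
      linarith
    nlinarith
  have hlower : ∀ σ : P ≃ V, 1 ≤ M * 𝔼 s : Fin 4 ↪ {p // p ∉ A},
      |quadDiff e (fun i => σ (s i))| * min |quadDiff e (fun i => σ (s i))| (64 * ε) := by
    intro σ
    have h1 := le_card_mul_expect_tuple_off
      (fun x => |quadDiff e x| * min |quadDiff e x| (64 * ε))
      (fun x => mul_nonneg (abs_nonneg _) (le_min (abs_nonneg _) (by positivity))) A σ t
    have h2 : 𝔼 σ : P ≃ V, quadDiff e (fun i => σ (t i)) ^ 2 -
        (𝔼 σ : P ≃ V, |quadDiff e (fun i => σ (t i))| ^ 3) / (4 * (64 * ε)) ≤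
        𝔼 σ : P ≃ V, |quadDiff e (fun i => σ (t i))| *
          min |quadDiff e (fun i => σ (t i))| (64 * ε) := by
      rw [Finset.expect_div, ← Finset.expect_sub_distrib]
      exact Finset.expect_le_expect fun σ _ => sq_sub_le_mul_min _ (by positivity)
    have h3 : ∀ a i, 𝔼 τ : P ≃ V, |quadDiff e (fun i => τ (t i))| *
        min |quadDiff e (fun i => τ (t i))| (64 * ε) * (if τ (t i) = σ a then (1 : ℝ) else 0) ≤
        64 * (n * (14 / 100000) / ((n - 1) * (n - 2))) := by
      intro a i
      refine le_trans (Finset.expect_le_expect fun τ _ => ?_)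
        (he.expect_sq_quadDiff_mul_indicator_le t hPV (t i) (σ a))
      refine mul_le_mul_of_nonneg_right ?_ (by split_ifs <;> norm_num)
      rw [← sq_abs, sq]
      exact mul_le_mul_of_nonneg_left (min_le_left _ _) (abs_nonneg _)
    have h4 : ∑ a ∈ A, ∑ i, 𝔼 τ : P ≃ V, |quadDiff e (fun i => τ (t i))| *
        min |quadDiff e (fun i => τ (t i))| (64 * ε) * (if τ (t i) = σ a then (1 : ℝ) else 0) ≤
        3072 * (n * (14 / 100000) / ((n - 1) * (n - 2))) := by
      refine (Finset.sum_le_sum fun a _ => Finset.sum_le_sum fun i _ => h3 a i).trans ?_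
      have h0 : 0 ≤ 64 * (n * (14 / 100000) / ((n - 1) * (n - 2))) :=
        mul_nonneg (by norm_num) (div_nonneg (by linarith)
          (mul_nonneg (by linarith) (by linarith)))
      have hA' : (#A : ℝ) ≤ 12 := by exact_mod_cast hA
      simp only [Finset.sum_const, card_univ, Fintype.card_fin, nsmul_eq_mul]
      push_cast
      nlinarith
    rw [hN4, hN4'] at h1
    rw [hsq] at h2
    set X := 𝔼 s : Fin 4 ↪ {p // p ∉ A}, |quadDiff e (fun i => σ (s i))| *
      min |quadDiff e (fun i => σ (s i))| (64 * ε)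
    have hX0 : 0 ≤ X := Finset.expect_nonneg fun s _ =>
      mul_nonneg (abs_nonneg _) (le_min (abs_nonneg _) (by positivity))
    have h5 : (𝔼 σ : P ≃ V, |quadDiff e (fun i => σ (t i))| ^ 3) / (4 * (64 * ε)) ≤
        2 / (n - 1) := by
      rw [div_le_div_iff₀ (by positivity) (by linarith)]
      have hn1 : 0 < n - 1 := by linarith
      have := mul_le_mul_of_nonneg_right hcube hn1.le
      refine this.trans (le_of_eq ?_)
      change 512 * (ε / (n - 1)) * (n - 1) = _
      field_simp
      norm_num
    have h6 := h1.trans (mul_le_mul_of_nonneg_right hcmp' hX0)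
    have h7 := le_of_mul_le_mul_left h6 hpos
    have h8 : 5 / n ≤ 8 * (n - 1) / (n * (n - 2)) - 2 / (n - 1) -
        3072 * (n * (14 / 100000) / ((n - 1) * (n - 2))) := by
      have hn0 : 0 < n := by linarith
      have hn1 : 0 < n - 1 := by linarith
      have hn2 : 0 < n - 2 := by linarith
      rw [← sub_nonneg]
      have : 8 * (n - 1) / (n * (n - 2)) - 2 / (n - 1) -
        3072 * (n * (14 / 100000) / ((n - 1) * (n - 2))) - 5 / n =
        (8 * (n - 1) ^ 2 - 2 * n * (n - 2) - 3072 * (14 / 100000) * n ^ 2 -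
          5 * (n - 1) * (n - 2)) / (n * (n - 1) * (n - 2)) := by
        field_simp
      rw [this]
      refine div_nonneg ?_ (by positivity)
      nlinarith
    have h9 : 5 / n ≤ X := by linarith
    have h10 : (M : ℝ) * (5 / n) ≤ M * X := mul_le_mul_of_nonneg_left h9 (Nat.cast_nonneg M)
    refine le_trans ?_ h10
    rw [mul_div_assoc', le_div_iff₀ (by linarith)]
    linarith
  have hmain := Matching.concentration B hB (quadDiff e) (quadDiff_swap e) hw0 hℓ0 hw hℓ hZ
    (δ := 64 * ε) (η := 200 * ε) (r := 100 / n) (C := 2.03) (by positivity) (by positivity)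
    hupper hlower (by positivity) hratio
  refine hmain.trans (Finset.expect_le_expect fun σ _ => mul_le_mul_of_nonneg_left ?_ (hw0 σ))
  have hn0 : 0 < n := by linarith
  have h1 : 100 / n * 2.03 ^ 2 / (2 * (200 * ε)) ≤ 73 * ε := by
    rw [div_le_iff₀ (by positivity), div_mul_eq_mul_div, div_le_iff₀ hn0]
    nlinarith
  have h2 : (64 * ε) ^ 2 * 2.03 / (2 * (200 * ε)) ≤ 21 * ε := by
    rw [div_le_iff₀ (by positivity)]
    nlinarith [sq_nonneg ε]
  rw [add_div ((64 * ε) ^ 2 * 2.03)]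
  have := hℓ0 σ
  nlinarith

end ArrayConcentration

section Stein

open Filter Topology MeasureTheory

/-- The unnormalised Gaussian density. -/
noncomputable def gaussDensity (x : ℝ) : ℝ := Real.exp (-(x ^ 2) / 2)

/-- The unnormalised lower Gaussian tail. -/
noncomputable def gaussTail (x : ℝ) : ℝ := ∫ t in Set.Iic x, gaussDensity t

theorem gaussDensity_pos (x : ℝ) : 0 < gaussDensity x := Real.exp_pos _

theorem gaussDensity_neg (x : ℝ) : gaussDensity (-x) = gaussDensity x := by
  simp [gaussDensity]

theorem continuous_gaussDensity : Continuous gaussDensity := by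
  unfold gaussDensity
  fun_prop

theorem integrable_gaussDensity : Integrable gaussDensity := by
  have h := integrable_exp_neg_mul_sq (b := 1 / 2) (by norm_num)
  refine h.congr (Eventually.of_forall fun x => ?_)
  simp only [gaussDensity]
  congr 1
  ring

theorem integral_gaussDensity : ∫ x, gaussDensity x = Real.sqrt (2 * Real.pi) := by
  have h := integral_gaussian (1 / 2)
  have h2 : Real.pi / (1 / 2) = 2 * Real.pi := by ring
  rw [h2] at h
  rw [← h]
  refine integral_congr_ae (Eventually.of_forall fun x => ?_)
  simp only [gaussDensity]
  congr 1
  ring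

theorem hasDerivAt_gaussDensity (x : ℝ) :
    HasDerivAt gaussDensity (-x * gaussDensity x) x := by
  have h : HasDerivAt (fun x : ℝ => -(x ^ 2) / 2) (-x) x := by
    have := ((hasDerivAt_pow 2 x).neg).div_const 2
    refine this.congr_deriv ?_
    norm_num
    ring
  refine h.exp.congr_deriv ?_
  simp only [gaussDensity]
  ring

theorem hasDerivAt_gaussTail (x : ℝ) : HasDerivAt gaussTail (gaussDensity x) x := by
  have h1 : gaussTail = fun y => gaussTail 0 + ∫ t in (0 : ℝ)..y, gaussDensity t := by
    funext y
    have := intervalIntegral.integral_Iic_sub_Iic (a := 0) (b := y)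
      (integrable_gaussDensity.integrableOn) (integrable_gaussDensity.integrableOn)
    simp only [gaussTail]
    linarith
  rw [h1]
  exact (intervalIntegral.integral_hasDerivAt_right
    (integrable_gaussDensity.intervalIntegrable)
    (continuous_gaussDensity.stronglyMeasurableAtFilter _ _)
    continuous_gaussDensity.continuousAt).const_add _

theorem tendsto_gaussTail_atBot : Tendsto gaussTail atBot (𝓝 0) := by
  have h := intervalIntegral_tendsto_integral_Iic (0 : ℝ)
    (integrable_gaussDensity.integrableOn (s := Set.Iic 0)) tendsto_id
  have h1 : gaussTail = fun y => gaussTail 0 - ∫ t in y..(0 : ℝ), gaussDensity t := by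
    funext y
    have := intervalIntegral.integral_Iic_sub_Iic (a := y) (b := 0)
      (integrable_gaussDensity.integrableOn) (integrable_gaussDensity.integrableOn)
    simp only [gaussTail]
    linarith
  have h2 : Tendsto (fun y => gaussTail 0 - ∫ t in y..(0 : ℝ), gaussDensity t) atBot
      (𝓝 (gaussTail 0 - gaussTail 0)) := tendsto_const_nhds.sub h
  rw [h1]
  rwa [sub_self] at h2

theorem gaussTail_add_neg (x : ℝ) : gaussTail x + gaussTail (-x) = Real.sqrt (2 * Real.pi) := by
  have h1 : gaussTail (-x) = ∫ t in Set.Ioi x, gaussDensity t := by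
    have := integral_comp_neg_Ioi x gaussDensity
    simp only [gaussDensity_neg] at this
    exact this.symm
  rw [h1, ← integral_gaussDensity, gaussTail,
    intervalIntegral.integral_Iic_add_Ioi integrable_gaussDensity.integrableOn
      integrable_gaussDensity.integrableOn]

theorem gaussTail_nonneg (x : ℝ) : 0 ≤ gaussTail x :=
  integral_nonneg fun t => (gaussDensity_pos t).le

theorem stdNormalCDF_eq (z : ℝ) : stdNormalCDF z = (Real.sqrt (2 * Real.pi))⁻¹ * gaussTail z := rfl

theorem sqrt_two_pi_pos : 0 < Real.sqrt (2 * Real.pi) := Real.sqrt_pos.2 (by positivity)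

theorem stdNormalCDF_nonneg (z : ℝ) : 0 ≤ stdNormalCDF z :=
  mul_nonneg (inv_nonneg.2 sqrt_two_pi_pos.le) (gaussTail_nonneg z)

theorem one_sub_stdNormalCDF (z : ℝ) : 1 - stdNormalCDF z = stdNormalCDF (-z) := by
  have := gaussTail_add_neg z
  have h := sqrt_two_pi_pos
  rw [stdNormalCDF_eq, stdNormalCDF_eq, sub_eq_iff_eq_add, ← mul_add, add_comm, this,
    inv_mul_cancel₀ h.ne']

theorem stdNormalCDF_le_one (z : ℝ) : stdNormalCDF z ≤ 1 := by
  have := one_sub_stdNormalCDF z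
  have := stdNormalCDF_nonneg (-z)
  linarith

theorem tendsto_gaussDensity_atBot : Tendsto gaussDensity atBot (𝓝 0) := by
  have h : Tendsto (fun x : ℝ => x ^ 2 / 2) atBot atTop := by
    have h := (tendsto_pow_atTop (α := ℝ) two_ne_zero).comp tendsto_neg_atBot_atTop
    refine (h.atTop_div_const two_pos).congr fun x => ?_
    simp
  have := Real.tendsto_exp_neg_atTop_nhds_zero.comp h
  refine this.congr fun x => ?_
  simp [gaussDensity, neg_div]

theorem nonneg_of_hasDerivAt_of_tendsto {F F' : ℝ → ℝ} (hF : ∀ x, HasDerivAt F (F' x) x)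
    (h0 : ∀ x, 0 ≤ F' x) (hlim : Tendsto F atBot (𝓝 0)) (x : ℝ) : 0 ≤ F x :=
  (monotone_of_hasDerivAt_nonneg hF h0).le_of_tendsto hlim x

/-- The Mills-ratio lower bound for the Gaussian tail. -/
theorem gaussTail_lower (x : ℝ) : 0 ≤ gaussTail x + x * gaussDensity x / (1 + x ^ 2) := by
  refine nonneg_of_hasDerivAt_of_tendsto
    (F := fun x => gaussTail x + x * gaussDensity x / (1 + x ^ 2)) (F' := fun x => 2 * gaussDensity x / (1 + x ^ 2) ^ 2) (fun x => ?_)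
    (fun x => by have := (gaussDensity_pos x).le; positivity) ?_ x
  · have hd : HasDerivAt (fun x : ℝ => 1 + x ^ 2) (2 * x) x := by
      simpa using (hasDerivAt_pow 2 x).const_add 1
    have hp : (1 : ℝ) + x ^ 2 ≠ 0 := by positivity
    refine ((hasDerivAt_gaussTail x).add
      (((hasDerivAt_id x).mul (hasDerivAt_gaussDensity x)).div hd hp)).congr_deriv ?_
    simp only [id, Pi.mul_apply]
    field_simp
    ring
  · rw [← add_zero (0 : ℝ)]
    refine tendsto_gaussTail_atBot.add (squeeze_zero_norm (fun x => ?_) tendsto_gaussDensity_atBot)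
    rw [Real.norm_eq_abs, abs_div, abs_mul, abs_of_pos (gaussDensity_pos x),
      abs_of_pos (by positivity : (0 : ℝ) < 1 + x ^ 2), div_le_iff₀ (by positivity)]
    have h1 : |x| ≤ 1 + x ^ 2 := by
      rw [← sq_abs]
      nlinarith [sq_nonneg (|x| - 1)]
    have := mul_le_mul_of_nonneg_left h1 (gaussDensity_pos x).le
    linarith

/-- The Mills-ratio upper bound for the Gaussian tail. -/
theorem neg_mul_gaussTail_le {x : ℝ} (hx : x < 0) : -x * gaussTail x ≤ gaussDensity x := by
  let F : ℝ → ℝ := fun x => gaussTail x + gaussDensity x / x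
  have hF : ∀ y < 0, HasDerivAt F (-gaussDensity y / y ^ 2) y := by
    intro y hy
    refine ((hasDerivAt_gaussTail y).add
      ((hasDerivAt_gaussDensity y).div (hasDerivAt_id y) hy.ne)).congr_deriv ?_
    have := hy.ne
    simp only [id]
    field_simp
    ring
  have hanti : AntitoneOn F (Set.Iio 0) := by
    refine antitoneOn_of_deriv_nonpos (convex_Iio 0)
      (fun y hy => (hF y hy).continuousAt.continuousWithinAt)
      (fun y hy => (hF y (by simpa using hy)).differentiableAt.differentiableWithinAt) ?_
    intro y hy
    rw [interior_Iio] at hy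
    rw [(hF y hy).deriv]
    exact div_nonpos_of_nonpos_of_nonneg (neg_nonpos.2 (gaussDensity_pos y).le) (sq_nonneg y)
  have hlim : Tendsto F atBot (𝓝 0) := by
    rw [← add_zero (0 : ℝ)]
    refine tendsto_gaussTail_atBot.add ?_
    have := tendsto_gaussDensity_atBot.mul tendsto_inv_atBot_zero
    simpa [div_eq_mul_inv] using this
  have h : F x ≤ 0 := by
    refine ge_of_tendsto hlim ?_
    filter_upwards [eventually_le_atBot x] with y hy
    exact hanti (lt_of_le_of_lt hy hx) hx hy
  have h2 : -x * F x = -x * gaussTail x - gaussDensity x := by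
    have := hx.ne
    simp only [F]
    field_simp
    ring
  nlinarith

/-- The ratio of the Gaussian tail to the Gaussian density. -/
noncomputable def mills (x : ℝ) : ℝ := gaussTail x / gaussDensity x

theorem mills_nonneg (x : ℝ) : 0 ≤ mills x :=
  div_nonneg (gaussTail_nonneg x) (gaussDensity_pos x).le

theorem hasDerivAt_mills (x : ℝ) : HasDerivAt mills (x * mills x + 1) x := by
  have hp := (gaussDensity_pos x).ne'
  refine ((hasDerivAt_gaussTail x).div (hasDerivAt_gaussDensity x) hp).congr_deriv ?_
  unfold mills
  field_simp
  ring

theorem monotone_mul_mills : Monotone fun x => x * mills x := by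
  refine monotone_of_hasDerivAt_nonneg
    (f' := fun x => 1 * mills x + x * (x * mills x + 1))
    (fun x => (hasDerivAt_id x).mul (hasDerivAt_mills x)) fun x => ?_
  have hp := gaussDensity_pos x
  have h := gaussTail_lower x
  have : 1 * mills x + x * (x * mills x + 1) =
      (1 + x ^ 2) / gaussDensity x * (gaussTail x + x * gaussDensity x / (1 + x ^ 2)) := by
    unfold mills
    field_simp
    ring
  simp only [Pi.zero_apply]
  rw [this]
  positivity

theorem neg_one_le_mul_mills {x : ℝ} (hx : x < 0) : -1 ≤ x * mills x := by
  have hp := gaussDensity_pos x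
  have h := neg_mul_gaussTail_le hx
  unfold mills
  rw [mul_div_assoc', le_div_iff₀ hp]
  linarith

/-- The solution of Stein's equation for the indicator of `(-∞, z]`. -/
noncomputable def steinSol (z x : ℝ) : ℝ :=
  if x ≤ z then (1 - stdNormalCDF z) * mills x else stdNormalCDF z * mills (-x)

theorem steinSol_boundary (z : ℝ) :
    (1 - stdNormalCDF z) * mills z = stdNormalCDF z * mills (-z) := by
  rw [one_sub_stdNormalCDF, stdNormalCDF_eq, stdNormalCDF_eq, mills, mills, gaussDensity_neg]
  ring

theorem steinSol_of_ge {z x : ℝ} (h : z ≤ x) :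
    steinSol z x = stdNormalCDF z * mills (-x) := by
  unfold steinSol
  split_ifs with h'
  · rw [le_antisymm h' h, steinSol_boundary]
  · rfl

theorem continuous_mills : Continuous mills :=
  continuous_iff_continuousAt.2 fun x => (hasDerivAt_mills x).continuousAt

theorem continuous_steinSol (z : ℝ) : Continuous (steinSol z) := by
  unfold steinSol
  refine Continuous.if_le (continuous_const.mul continuous_mills)
    (continuous_const.mul (continuous_mills.comp continuous_neg)) continuous_id continuous_const ?_
  rintro x rfl
  exact steinSol_boundary x

theorem monotone_mul_steinSol (z : ℝ) : Monotone fun x => x * steinSol z x := by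
  have hΦ := stdNormalCDF_nonneg z
  have hΦ' : 0 ≤ 1 - stdNormalCDF z := by
    have := stdNormalCDF_le_one z
    linarith
  have h1 : MonotoneOn (fun x => x * steinSol z x) (Set.Iic z) := by
    intro x hx y hy hxy
    have h := mul_le_mul_of_nonneg_left (monotone_mul_mills hxy) hΦ'
    simp only [Set.mem_Iic] at hx hy
    simp only [steinSol, if_pos hx, if_pos hy] at h ⊢
    linarith
  have h2 : MonotoneOn (fun x => x * steinSol z x) (Set.Ici z) := by
    intro x hx y hy hxy
    have h := mul_le_mul_of_nonneg_left (monotone_mul_mills (neg_le_neg hxy)) hΦ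
    simp only [Set.mem_Ici] at hx hy
    simp only [steinSol_of_ge hx, steinSol_of_ge hy] at h ⊢
    linarith
  exact MonotoneOn.Iic_union_Ici h1 h2

theorem mul_steinSol_le_one (z x : ℝ) : x * steinSol z x ≤ 1 := by
  refine (monotone_mul_steinSol z (le_max_left x (max z 1))).trans ?_
  set y := max x (max z 1)
  have hz : z ≤ y := (le_max_left _ _).trans (le_max_right _ _)
  have h1 : 1 ≤ y := (le_max_right z 1).trans (le_max_right _ _)
  have h := neg_one_le_mul_mills (x := -y) (by linarith)
  simp only [steinSol_of_ge hz]
  have h0 := mul_nonneg (by linarith : 0 ≤ y) (mills_nonneg (-y))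
  have := mul_le_mul (stdNormalCDF_le_one z) (by linarith : y * mills (-y) ≤ 1) h0 zero_le_one
  linarith

theorem neg_one_le_mul_steinSol (z x : ℝ) : -1 ≤ x * steinSol z x := by
  refine le_trans ?_ (monotone_mul_steinSol z (min_le_left x (min z (-1))))
  set y := min x (min z (-1))
  have hz : y ≤ z := (min_le_right _ _).trans (min_le_left _ _)
  have h1 : y ≤ -1 := (min_le_right _ _).trans (min_le_right _ _)
  have h := neg_one_le_mul_mills (x := y) (by linarith)
  simp only [steinSol, if_pos hz]
  have h0 := mul_nonneg (by linarith : 0 ≤ -y) (mills_nonneg y)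
  have hΦ := stdNormalCDF_nonneg z
  have := mul_le_mul (by linarith : 1 - stdNormalCDF z ≤ 1)
    (by linarith : -y * mills y ≤ 1) h0 zero_le_one
  linarith

theorem hasDerivWithinAt_steinSol (z x : ℝ) :
    HasDerivWithinAt (steinSol z)
      (x * steinSol z x + (if x < z then 1 else 0) - stdNormalCDF z) (Set.Ici x) x := by
  split_ifs with h
  · have h1 : HasDerivAt (fun x => (1 - stdNormalCDF z) * mills x)
        ((1 - stdNormalCDF z) * (x * mills x + 1)) x := (hasDerivAt_mills x).const_mul _
    have h2 : steinSol z =ᶠ[𝓝 x] fun x => (1 - stdNormalCDF z) * mills x := by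
      filter_upwards [eventually_lt_nhds h] with y hy
      rw [steinSol, if_pos hy.le]
    have h3 := (h1.congr_of_eventuallyEq h2).hasDerivWithinAt (s := Set.Ici x)
    refine h3.congr_deriv ?_
    rw [steinSol, if_pos h.le]
    ring
  · rw [not_lt] at h
    have h1 : HasDerivAt (fun x => stdNormalCDF z * mills (-x))
        (stdNormalCDF z * ((-x * mills (-x) + 1) * -1)) x :=
      ((hasDerivAt_mills (-x)).comp x (hasDerivAt_neg x)).const_mul _
    refine (h1.hasDerivWithinAt.congr (fun y hy => steinSol_of_ge (h.trans hy))
      (steinSol_of_ge h)).congr_deriv ?_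
    rw [steinSol_of_ge h]
    ring

/-- The value at `x` of the derivative of `steinSol z` predicted by Stein's equation. -/
noncomputable def steinDeriv (z x : ℝ) : ℝ :=
  x * steinSol z x + (if x ≤ z then 1 else 0) - stdNormalCDF z

theorem abs_steinDeriv_le (z x : ℝ) : |steinDeriv z x| ≤ 3 := by
  have h1 := mul_steinSol_le_one z x
  have h2 := neg_one_le_mul_steinSol z x
  have h3 := stdNormalCDF_nonneg z
  have h4 := stdNormalCDF_le_one z
  unfold steinDeriv
  rw [abs_le]
  split_ifs <;> constructor <;> linarith

theorem abs_steinSol_sub_le {a b c x y : ℝ} (z : ℝ) (hc : c ∈ Set.Icc a b)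
    (hx : x ∈ Set.Icc a b) (hy : y ∈ Set.Icc a b) :
    |steinSol z y - steinSol z x - steinDeriv z c * (y - x)| ≤
      (b * steinSol z b - a * steinSol z a + (if a ≤ z ∧ z ≤ b then 1 else 0)) * |y - x| := by
  wlog hxy : x ≤ y generalizing x y
  · have h := this hy hx (le_of_not_ge hxy)
    rw [abs_sub_comm x y] at h
    rw [← abs_neg]
    refine le_trans (le_of_eq ?_) h
    congr 1
    ring
  set L := b * steinSol z b - a * steinSol z a + (if a ≤ z ∧ z ≤ b then (1 : ℝ) else 0)
  have hd : ∀ t ∈ Set.Ico x y, HasDerivWithinAt (fun t => steinSol z t - steinDeriv z c * t)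
      (t * steinSol z t + (if t < z then 1 else 0) - stdNormalCDF z - steinDeriv z c)
      (Set.Ici t) t := by
    intro t _
    have h1 : HasDerivWithinAt (fun t => steinDeriv z c * t) (steinDeriv z c) (Set.Ici t) t := by
      simpa using ((hasDerivAt_id t).const_mul (steinDeriv z c)).hasDerivWithinAt
    exact (hasDerivWithinAt_steinSol z t).sub h1
  have hb : ∀ t ∈ Set.Ico x y,
      ‖t * steinSol z t + (if t < z then 1 else 0) - stdNormalCDF z - steinDeriv z c‖ ≤ L := by
    intro t ht
    have hta : a ≤ t := hx.1.trans ht.1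
    have htb : t ≤ b := ht.2.le.trans hy.2
    have m1 := monotone_mul_steinSol z hta
    have m2 := monotone_mul_steinSol z htb
    have m3 := monotone_mul_steinSol z hc.1
    have m4 := monotone_mul_steinSol z hc.2
    simp only at m1 m2 m3 m4
    have hi : |(if t < z then (1 : ℝ) else 0) - (if c ≤ z then 1 else 0)| ≤
        if a ≤ z ∧ z ≤ b then (1 : ℝ) else 0 := by
      have hc1 := hc.1
      have hc2 := hc.2
      split_ifs with h1 h2 h3 h3 h2 h3 h3 <;> norm_num
      · exact h3 ⟨by linarith, by linarith⟩
      · exact h3 ⟨by linarith, by linarith⟩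
    rw [abs_le] at hi
    rw [Real.norm_eq_abs, steinDeriv, abs_le]
    constructor <;> linarith [hi.1, hi.2]
  have := norm_image_sub_le_of_norm_deriv_right_le_segment (f := fun t =>
    steinSol z t - steinDeriv z c * t)
    ((continuous_steinSol z).sub (continuous_const.mul continuous_id)).continuousOn hd hb y
    (Set.right_mem_Icc.2 hxy)
  rw [abs_of_nonneg (sub_nonneg.2 hxy)]
  rw [Real.norm_eq_abs] at this
  refine le_trans (le_of_eq ?_) this
  congr 1
  ring

end Stein

section MatchingSum

variable {R V : Type*} [Fintype R] [DecidableEq R] [Fintype V] [DecidableEq V]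

/-- The sum of `e` over the ordered pairs of labels matched by `σ`. -/
def matchSum (e : V → V → ℝ) (σ : R × Bool ≃ V) : ℝ := ∑ p, e (σ p) (σ (p.1, !p.2))

/-- The label of the edge over `r`. -/
def edge (e : V → V → ℝ) (σ : R × Bool ≃ V) (r : R) : ℝ := e (σ (r, false)) (σ (r, true))

/-- The four positions of the edges over `r` and `s`. -/
def quadPos (r s : R) : Fin 4 → R × Bool := ![(r, false), (r, true), (s, false), (s, true)]

theorem quadPos_injective {r s : R} (h : r ≠ s) : Function.Injective (quadPos r s) := by
  intro i j hij
  fin_cases i <;> fin_cases j <;> simp_all [quadPos, h.symm]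

variable {e : V → V → ℝ}

theorem matchSum_eq (hs : ∀ v w, e v w = e w v) (σ : R × Bool ≃ V) :
    matchSum e σ = 2 * ∑ r, edge e σ r := by
  unfold matchSum edge
  rw [Fintype.sum_prod_type, Finset.mul_sum]
  refine Finset.sum_congr rfl fun r _ => ?_
  rw [Fintype.sum_bool]
  simp only [Bool.not_true, Bool.not_false]
  rw [hs (σ (r, true))]
  ring

theorem matchSum_trans (g : Equiv.Perm (R × Bool)) (hg : ∀ p, g (p.1, !p.2) = ((g p).1, !(g p).2))
    (σ : R × Bool ≃ V) : matchSum e (g.trans σ) = matchSum e σ := by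
  unfold matchSum
  simp only [Equiv.trans_apply, hg]
  exact Equiv.sum_comp g fun p => e (σ p) (σ (p.1, !p.2))

theorem sum_edge_swap (s : Finset R) {r r' : R} (hr : r ∈ s) (hr' : r' ∈ s) (h : r ≠ r')
    (σ : R × Bool ≃ V) :
    2 * ∑ x ∈ s, edge e ((Equiv.swap (r, true) (r', false)).trans σ) x =
      2 * ∑ x ∈ s, edge e σ x + quadDiff e (fun i => σ (quadPos r r' i)) := by
  have hother : ∀ x ∈ (s.erase r).erase r',
      edge e ((Equiv.swap (r, true) (r', false)).trans σ) x = edge e σ x := by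
    intro x hx
    simp only [mem_erase] at hx
    unfold edge
    simp only [Equiv.trans_apply]
    rw [Equiv.swap_apply_of_ne_of_ne (by simp) (by simp [hx.1]),
      Equiv.swap_apply_of_ne_of_ne (by simp [hx.2.1]) (by simp)]
  have h1 : ∀ w : R → ℝ, ∑ x ∈ s, w x = w r + (w r' + ∑ x ∈ (s.erase r).erase r', w x) :=
    fun w => by
      rw [Finset.add_sum_erase _ _ (mem_erase.2 ⟨h.symm, hr'⟩), Finset.add_sum_erase _ _ hr]
  rw [h1, h1 (edge e σ), Finset.sum_congr rfl hother]
  have h2 : edge e ((Equiv.swap (r, true) (r', false)).trans σ) r =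
      e (σ (r, false)) (σ (r', false)) := by
    unfold edge
    simp only [Equiv.trans_apply]
    rw [Equiv.swap_apply_left, Equiv.swap_apply_of_ne_of_ne (by simp) (by simp [h])]
  have h3 : edge e ((Equiv.swap (r, true) (r', false)).trans σ) r' =
      e (σ (r, true)) (σ (r', true)) := by
    unfold edge
    simp only [Equiv.trans_apply]
    rw [Equiv.swap_apply_right, Equiv.swap_apply_of_ne_of_ne (by simp [h.symm]) (by simp)]
  have h4 : edge e σ r = e (σ (r, false)) (σ (r, true)) := rfl
  have h5 : edge e σ r' = e (σ (r', false)) (σ (r', true)) := rfl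
  rw [h2, h3, h4, h5]
  simp only [quadDiff, quadPos, Matrix.cons_val]
  ring

theorem matchSum_swap (hs : ∀ v w, e v w = e w v) {r r' : R} (h : r ≠ r') (σ : R × Bool ≃ V) :
    matchSum e ((Equiv.swap (r, true) (r', false)).trans σ) =
      matchSum e σ + quadDiff e (fun i => σ (quadPos r r' i)) := by
  rw [matchSum_eq hs, matchSum_eq hs]
  exact sum_edge_swap univ (mem_univ _) (mem_univ _) h σ

/-- Permuting the pairs and flipping some of them. -/
def pairPerm (τ : Equiv.Perm R) (c : R → Bool) : Equiv.Perm (R × Bool) :=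
  ⟨fun p => (τ p.1, xor p.2 (c p.1)), fun p => (τ.symm p.1, xor p.2 (c (τ.symm p.1))),
    fun p => by simp, fun p => by simp⟩

theorem pairPerm_apply (τ : Equiv.Perm R) (c : R → Bool) (r : R) (b : Bool) :
    pairPerm τ c (r, b) = (τ r, xor b (c r)) := rfl

theorem expect_pairPerm (τ : Equiv.Perm R) (c : R → Bool) (F : (R × Bool ≃ V) → ℝ)
    (f : ℝ → ℝ) :
    𝔼 σ, F ((pairPerm τ c).trans σ) * f (matchSum e σ) = 𝔼 σ, F σ * f (matchSum e σ) := by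
  rw [← expect_perm (pairPerm τ c) fun σ => F σ * f (matchSum e σ)]
  refine Finset.expect_congr rfl fun σ _ => ?_
  rw [matchSum_trans]
  intro p
  obtain ⟨r, b⟩ := p
  simp [pairPerm_apply]

/-- The exchangeable pair identity for the matching sum. -/
theorem IsArr.expect_matchSum_mul {ε : ℝ} (he : IsArr e ε) {r₀ r₁ : R} (h01 : r₀ ≠ r₁)
    (hPV : Nonempty (R × Bool ≃ V)) (f : ℝ → ℝ) :
    𝔼 σ : R × Bool ≃ V, matchSum e σ * f (matchSum e σ) =
      (Fintype.card V : ℝ) * (Fintype.card V - 2) / (8 * (Fintype.card V - 1)) *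
        𝔼 σ : R × Bool ≃ V, quadDiff e (fun i => σ (quadPos r₀ r₁ i)) *
          (f (matchSum e σ + quadDiff e (fun i => σ (quadPos r₀ r₁ i))) - f (matchSum e σ)) := by
  have hl := he.large
  have hcard : (Fintype.card V : ℝ) = 2 * Fintype.card R := by
    rw [← card_eq hPV, Fintype.card_prod, Fintype.card_bool]
    push_cast
    ring
  set n : ℝ := (Fintype.card V : ℝ)
  -- antisymmetry under the swap
  have hanti : 𝔼 σ : R × Bool ≃ V, quadDiff e (fun i => σ (quadPos r₀ r₁ i)) *
      f (matchSum e σ + quadDiff e (fun i => σ (quadPos r₀ r₁ i))) =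
      -𝔼 σ : R × Bool ≃ V, quadDiff e (fun i => σ (quadPos r₀ r₁ i)) * f (matchSum e σ) := by
    rw [← expect_perm (Equiv.swap (r₀, true) (r₁, false))
      fun σ => quadDiff e (fun i => σ (quadPos r₀ r₁ i)) * f (matchSum e σ),
      ← Finset.expect_neg_distrib]
    refine Finset.expect_congr rfl fun σ _ => ?_
    rw [matchSum_swap he.symm h01]
    have : quadDiff e (fun i => ((Equiv.swap (r₀, true) (r₁, false)).trans σ) (quadPos r₀ r₁ i)) =
        -quadDiff e (fun i => σ (quadPos r₀ r₁ i)) := by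
      rw [← quadDiff_swap]
      congr 1
      funext i
      simp only [Equiv.trans_apply]
      exact congrArg σ ((quadPos_injective h01).swap_apply 1 2 i)
    rw [this]
    ring
  obtain ⟨a, ha⟩ : ∃ a, 𝔼 σ : R × Bool ≃ V, edge e σ r₀ * f (matchSum e σ) = a := ⟨_, rfl⟩
  obtain ⟨b, hb⟩ : ∃ b, 𝔼 σ : R × Bool ≃ V,
    e (σ (r₀, false)) (σ (r₁, false)) * f (matchSum e σ) = b := ⟨_, rfl⟩
  have hea : ∀ r, 𝔼 σ : R × Bool ≃ V, edge e σ r * f (matchSum e σ) = a := by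
    intro r
    rw [← ha, ← expect_pairPerm (Equiv.swap r r₀) (fun _ => false) fun σ => edge e σ r]
    refine Finset.expect_congr rfl fun σ _ => ?_
    simp [edge, pairPerm_apply]
  have heb : ∀ s b', s ≠ r₀ → 𝔼 σ : R × Bool ≃ V,
      e (σ (r₀, false)) (σ (s, b')) * f (matchSum e σ) = b := by
    intro s b' hs
    rw [← hb, ← expect_pairPerm (Equiv.swap s r₁) (fun r => if r = s then b' else false)
      fun σ => e (σ (r₀, false)) (σ (s, b'))]
    refine Finset.expect_congr rfl fun σ _ => ?_
    simp [pairPerm_apply, hs.symm, Equiv.swap_apply_of_ne_of_ne hs.symm h01]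
  have he13 : 𝔼 σ : R × Bool ≃ V, e (σ (r₀, true)) (σ (r₁, true)) * f (matchSum e σ) = b := by
    rw [← heb r₁ true h01.symm, ← expect_pairPerm (Equiv.refl R) (fun r => decide (r = r₀))
      fun σ => e (σ (r₀, true)) (σ (r₁, true))]
    refine Finset.expect_congr rfl fun σ _ => ?_
    simp [pairPerm_apply, h01.symm]
  have hY : 𝔼 σ : R × Bool ≃ V, matchSum e σ * f (matchSum e σ) = n * a := by
    have : ∀ σ : R × Bool ≃ V, matchSum e σ * f (matchSum e σ) =
        2 * ∑ r, edge e σ r * f (matchSum e σ) := fun σ => by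
      rw [← Finset.sum_mul, ← mul_assoc, ← matchSum_eq he.symm]
    simp only [this, ← Finset.mul_expect, Finset.expect_sum_comm, hea]
    rw [Finset.sum_const, card_univ, nsmul_eq_mul, hcard]
    ring
  have hrow : a + (n - 2) * b = 0 := by
    have h0 : ∀ σ : R × Bool ≃ V,
        ∑ p, e (σ (r₀, false)) (σ p) * f (matchSum e σ) = 0 := fun σ => by
      rw [← Finset.sum_mul, Equiv.sum_comp σ (e (σ (r₀, false))), he.row, zero_mul]
    have h1 : ∑ p, 𝔼 σ : R × Bool ≃ V, e (σ (r₀, false)) (σ p) * f (matchSum e σ) = 0 := by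
      rw [← Finset.expect_sum_comm, Finset.expect_congr rfl fun σ _ => h0 σ]
      simp
    rw [Fintype.sum_prod_type, ← Finset.add_sum_erase _ _ (mem_univ r₀)] at h1
    have h2 : ∀ s ∈ univ.erase r₀, ∑ b', 𝔼 σ : R × Bool ≃ V,
        e (σ (r₀, false)) (σ (s, b')) * f (matchSum e σ) = 2 * b := by
      intro s hs
      rw [Fintype.sum_bool, heb s _ (ne_of_mem_erase hs), heb s _ (ne_of_mem_erase hs)]
      ring
    rw [Finset.sum_congr rfl h2, Fintype.sum_bool, Finset.sum_const, card_erase_of_mem (mem_univ _),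
      card_univ, nsmul_eq_mul, Nat.cast_sub (Fintype.card_pos_iff.2 ⟨r₀⟩)] at h1
    simp only [he.diag, zero_mul, Finset.expect_const_zero, add_zero] at h1
    have h3 := hea r₀
    unfold edge at h3
    rw [h3] at h1
    rw [hcard]
    push_cast at h1
    linarith
  have hD : 𝔼 σ : R × Bool ≃ V, quadDiff e (fun i => σ (quadPos r₀ r₁ i)) * f (matchSum e σ) =
      4 * b - 4 * a := by
    have : ∀ σ : R × Bool ≃ V, quadDiff e (fun i => σ (quadPos r₀ r₁ i)) * f (matchSum e σ) =
        2 * (e (σ (r₀, false)) (σ (r₁, false)) * f (matchSum e σ)) +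
        2 * (e (σ (r₀, true)) (σ (r₁, true)) * f (matchSum e σ)) -
        2 * (edge e σ r₀ * f (matchSum e σ)) - 2 * (edge e σ r₁ * f (matchSum e σ)) := fun σ => by
      simp only [quadDiff, quadPos, edge, Matrix.cons_val]
      ring
    simp only [this, Finset.expect_sub_distrib, Finset.expect_add_distrib, ← Finset.mul_expect,
      hb, he13, hea]
    ring
  simp only [mul_sub, Finset.expect_sub_distrib]
  rw [hanti, hD, hY]
  have h1 : n - 1 ≠ 0 := by linarith
  have ha' : a = -(n - 2) * b := by linarith
  rw [ha']
  field_simp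
  ring

end MatchingSum

section Decoupling

variable {R V : Type*} [Fintype R] [DecidableEq R] [Fintype V] [DecidableEq V]

theorem exists_pairPerm (q t : Fin 4 ↪ R × Bool) (hq : Function.Injective fun i => (q i).1)
    (ht : Function.Injective fun i => (t i).1) :
    ∃ (τ : Equiv.Perm R) (c : R → Bool), ∀ i, pairPerm τ c (q i) = t i := by
  obtain ⟨τ, -, hτ⟩ := exists_perm_of_embeddings (∅ : Finset R) ⟨fun i => (q i).1, hq⟩
    ⟨fun i => (t i).1, ht⟩ (by simp) (by simp)
  refine ⟨τ, fun r => decide (∃ i, (q i).1 = r ∧ (q i).2 ≠ (t i).2), fun i => ?_⟩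
  have h1 : (∃ j, (q j).1 = (q i).1 ∧ (q j).2 ≠ (t j).2) ↔ (q i).2 ≠ (t i).2 :=
    ⟨fun ⟨j, hj, h⟩ => by rwa [hq hj] at h, fun h => ⟨i, rfl, h⟩⟩
  refine Prod.ext (hτ i) ?_
  show xor (q i).2 (decide _) = _
  rw [decide_eq_decide.2 h1]
  have h2 : ∀ x y : Bool, xor x (decide (x ≠ y)) = y := by decide
  convert h2 _ _

theorem card_embedding_pair_le {i j : Fin 4} (hij : i ≠ j) (hR : 2 ≤ Fintype.card R) :
    ((univ.filter fun q : Fin 4 ↪ R × Bool => (q i).1 = (q j).1).card : ℝ) ≤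
      (Fintype.card (R × Bool) : ℝ) * (Fintype.card (R × Bool) - 1) *
        (Fintype.card (R × Bool) - 2) := by
  have h1 : (univ.filter fun q : Fin 4 ↪ R × Bool => (q i).1 = (q j).1).card ≤
      Fintype.card ({k : Fin 4 // k ≠ j} ↪ R × Bool) := by
    rw [← card_univ]
    refine Finset.card_le_card_of_injOn
      (fun q => (Function.Embedding.subtype _).trans q) (fun _ _ => mem_univ _) ?_
    intro q hq q' hq' h
    simp only [coe_filter, mem_univ, true_and, Set.mem_ofPred_eq] at hq hq'
    have hk : ∀ k, k ≠ j → q k = q' k := fun k hk => DFunLike.congr_fun h ⟨k, hk⟩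
    have hi := hk i hij
    ext1 k
    by_cases hkj : k = j
    · subst hkj
      have h2 : (q k).2 ≠ (q i).2 := fun h2 => hij (q.injective (Prod.ext hq h2.symm))
      have h3 : (q' k).2 ≠ (q' i).2 := fun h3 => hij (q'.injective (Prod.ext hq' h3.symm))
      refine Prod.ext ?_ ?_
      · rw [← hq, ← hq', hi]
      · rw [← hi] at h3
        revert h2 h3
        cases (q k).2 <;> cases (q i).2 <;> cases (q' k).2 <;> simp
    · exact hk k hkj
  have h2 : Fintype.card {k : Fin 4 // k ≠ j} = 3 := by
    rw [Fintype.card_subtype_compl]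
    simp
  rw [Fintype.card_embedding_eq, h2] at h1
  have h3 : 4 ≤ Fintype.card (R × Bool) := by
    rw [Fintype.card_prod, Fintype.card_bool]
    omega
  obtain ⟨k, hk⟩ := Nat.exists_eq_add_of_le h3
  rw [hk] at h1 ⊢
  refine (Nat.cast_le.2 h1).trans (le_of_eq ?_)
  simp [Nat.descFactorial, show 4 + k - 1 = k + 3 by omega, show 4 + k - 2 = k + 2 by omega]
  ring

theorem card_embedding_not_injective_le (hR : 2 ≤ Fintype.card R) :
    ((univ.filter fun q : Fin 4 ↪ R × Bool =>
        ¬Function.Injective fun i => (q i).1).card : ℝ) ≤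
      16 * ((Fintype.card (R × Bool) : ℝ) * (Fintype.card (R × Bool) - 1) *
        (Fintype.card (R × Bool) - 2)) := by
  have h1 : (univ.filter fun q : Fin 4 ↪ R × Bool => ¬Function.Injective fun i => (q i).1) ⊆
      (univ.filter fun x : Fin 4 × Fin 4 => x.1 ≠ x.2).biUnion fun x =>
        univ.filter fun q : Fin 4 ↪ R × Bool => (q x.1).1 = (q x.2).1 := by
    intro q hq
    simp only [mem_filter, mem_univ, true_and, Function.Injective, not_forall] at hq
    obtain ⟨i, j, h, hij⟩ := hq
    simp only [mem_biUnion, mem_filter, mem_univ, true_and]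
    exact ⟨(i, j), hij, h⟩
  have h0 : (4 : ℝ) ≤ Fintype.card (R × Bool) := by
    rw [Fintype.card_prod, Fintype.card_bool]
    push_cast
    have : (2 : ℝ) ≤ Fintype.card R := by exact_mod_cast hR
    linarith
  set n : ℝ := (Fintype.card (R × Bool) : ℝ) with hn
  have h2 := (Finset.card_le_card h1).trans Finset.card_biUnion_le
  refine (Nat.cast_le.2 h2).trans ?_
  rw [Nat.cast_sum]
  refine (Finset.sum_le_card_nsmul _ _ _ fun x hx =>
    card_embedding_pair_le (mem_filter.1 hx).2 hR).trans ?_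
  rw [← hn, nsmul_eq_mul]
  have h3 : ((univ.filter fun x : Fin 4 × Fin 4 => x.1 ≠ x.2).card : ℝ) ≤ 16 := by
    have : (univ.filter fun x : Fin 4 × Fin 4 => x.1 ≠ x.2).card ≤ 16 := by decide
    exact_mod_cast this
  have h4 : 0 ≤ n * (n - 1) * (n - 2) :=
    mul_nonneg (mul_nonneg (by linarith) (by linarith)) (by linarith)
  exact mul_le_mul_of_nonneg_right h3 h4

/-- A function of four labels over different edges nearly decouples from the matching sum. -/
theorem abs_expect_decouple_le {e : V → V → ℝ} (hPV : Nonempty (R × Bool ≃ V))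
    (hR : 2 ≤ Fintype.card R) (h : (Fin 4 → V) → ℝ) (hh : ∀ x, 0 ≤ h x) {g : ℝ → ℝ} {C : ℝ}
    (hg : ∀ y, |g y| ≤ C) (t t' : Fin 4 ↪ R × Bool) (ht : Function.Injective fun i => (t i).1) :
    |(𝔼 σ : R × Bool ≃ V, h (fun i => σ (t' i))) * (𝔼 σ : R × Bool ≃ V, g (matchSum e σ)) -
        𝔼 σ : R × Bool ≃ V, h (fun i => σ (t i)) * g (matchSum e σ)| ≤
      32 * C / (Fintype.card V - 3) * 𝔼 σ : R × Bool ≃ V, h (fun i => σ (t' i)) := by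
  have h0 : (4 : ℝ) ≤ Fintype.card V := by
    rw [← card_eq hPV, Fintype.card_prod, Fintype.card_bool]
    push_cast
    have : (2 : ℝ) ≤ Fintype.card R := by exact_mod_cast hR
    linarith
  have hcard := card_eq hPV
  have hN := card_embedding_four (R × Bool) (by
    have : 4 ≤ Fintype.card (R × Bool) := by
      rw [Fintype.card_prod, Fintype.card_bool]
      omega
    omega)
  have hbad := card_embedding_not_injective_le hR
  rw [hcard] at hN hbad
  have hm : ∀ q : Fin 4 ↪ R × Bool, 𝔼 σ : R × Bool ≃ V, h (fun i => σ (q i)) =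
      𝔼 σ : R × Bool ≃ V, h (fun i => σ (t' i)) := fun q =>
    expect_tuple_eq (A := ∅) (G := fun _ x => h x) (localOn_of_forall fun _ _ _ => rfl)
      q t' (by simp) (by simp)
  obtain ⟨m, hm'⟩ : ∃ m, 𝔼 σ : R × Bool ≃ V, h (fun i => σ (t' i)) = m := ⟨_, rfl⟩
  rw [hm'] at hm ⊢
  set T : (Fin 4 ↪ R × Bool) → ℝ := fun q =>
    𝔼 σ : R × Bool ≃ V, h (fun i => σ (q i)) * g (matchSum e σ) with hT
  show |m * _ - T t| ≤ _
  have hTb : ∀ q, |T q| ≤ C * m := fun q => by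
    rw [← hm q, Finset.mul_expect]
    refine (Finset.abs_expect_le _ _).trans (Finset.expect_le_expect fun σ _ => ?_)
    rw [abs_mul, abs_of_nonneg (hh _), mul_comm]
    exact mul_le_mul_of_nonneg_right (hg _) (hh _)
  have hTg : ∀ q : Fin 4 ↪ R × Bool, (Function.Injective fun i => (q i).1) → T q = T t := by
    intro q hq
    obtain ⟨τ, c, hτ⟩ := exists_pairPerm q t hq ht
    simp only [hT]
    rw [← expect_pairPerm τ c fun σ => h (fun i => σ (q i))]
    simp only [Equiv.trans_apply, hτ]
  have hsum : ∑ q, T q = (Fintype.card (Fin 4 ↪ R × Bool) : ℝ) *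
      (m * 𝔼 σ : R × Bool ≃ V, g (matchSum e σ)) := by
    simp only [hT]
    rw [← Finset.expect_sum_comm, ← mul_assoc, Finset.mul_expect]
    refine Finset.expect_congr rfl fun σ _ => ?_
    rw [← Finset.sum_mul, ← hm', card_mul_expect_tuple hPV h t']
    congr 1
    exact Fintype.sum_equiv (Equiv.embeddingCongr (Equiv.refl _) σ) _ _ fun q => by
      simp [Equiv.embeddingCongr]
  have hkey : (Fintype.card (Fin 4 ↪ R × Bool) : ℝ) *
      (m * (𝔼 σ : R × Bool ≃ V, g (matchSum e σ)) - T t) =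
      ∑ q ∈ univ.filter (fun q : Fin 4 ↪ R × Bool => ¬Function.Injective fun i => (q i).1),
        (T q - T t) := by
    rw [mul_sub, ← hsum, Finset.sum_filter]
    have : ∀ q : Fin 4 ↪ R × Bool, (if ¬Function.Injective (fun i => (q i).1) then T q - T t
        else 0) = T q - T t := fun q => by
      split_ifs with hq
      · rw [hTg q hq, sub_self]
      · rfl
    rw [Finset.sum_congr rfl fun q _ => this q, Finset.sum_sub_distrib, Finset.sum_const,
      card_univ, nsmul_eq_mul]
  have habs := congrArg abs hkey
  rw [abs_mul, Nat.abs_cast] at habs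
  have h1 : |∑ q ∈ univ.filter (fun q : Fin 4 ↪ R × Bool =>
      ¬Function.Injective fun i => (q i).1), (T q - T t)| ≤
      ((univ.filter fun q : Fin 4 ↪ R × Bool =>
        ¬Function.Injective fun i => (q i).1).card : ℝ) * (2 * (C * m)) := by
    refine (Finset.abs_sum_le_sum_abs _ _).trans ?_
    rw [← nsmul_eq_mul]
    refine Finset.sum_le_card_nsmul _ _ _ fun q _ => ?_
    have := abs_sub (T q) (T t)
    have := hTb q
    have := hTb t
    linarith
  have hCm : 0 ≤ 2 * (C * m) := by
    have := (abs_nonneg _).trans (hTb t)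
    linarith
  rw [← habs, hN] at h1
  have h2 := h1.trans (mul_le_mul_of_nonneg_right hbad hCm)
  set n : ℝ := (Fintype.card V : ℝ)
  have h3 : 0 < n * (n - 1) * (n - 2) :=
    mul_pos (mul_pos (by linarith) (by linarith)) (by linarith)
  have h4 : 0 < n - 3 := by linarith
  rw [div_mul_eq_mul_div, le_div_iff₀ h4]
  refine le_of_mul_le_mul_left ?_ h3
  linarith

end Decoupling

section Averaging

variable {Ω : Type*} [Fintype Ω]

theorem integral_indicator_Ioo {x y : ℝ} (hx : -1 ≤ x) (hxy : x ≤ y) (hy : y ≤ 1) :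
    ∫ t in Set.Icc (-1 : ℝ) 1, (Set.Ioo x y).indicator (fun _ => (1 : ℝ)) t = y - x := by
  have h : Set.Icc (-1 : ℝ) 1 ∩ Set.Ioo x y = Set.Ioo x y :=
    Set.inter_eq_right.2 fun t ht => ⟨hx.trans ht.1.le, ht.2.le.trans hy⟩
  rw [MeasureTheory.setIntegral_indicator measurableSet_Ioo, h,
    MeasureTheory.setIntegral_const, Real.volume_real_Ioo_of_le hxy]
  simp

theorem expect_mul_sub_le {w a b : Ω → ℝ} {u : ℝ → ℝ} {Γ : ℝ} (hw : ∀ σ, 0 ≤ w σ)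
    (hab : ∀ σ, a σ ≤ b σ) (hu : Monotone u) (hc : Continuous u) (hu1 : ∀ x, u x ≤ 1)
    (hu1' : ∀ x, -1 ≤ u x)
    (hΓ : ∀ s, 𝔼 σ, w σ * (if a σ ≤ s ∧ s ≤ b σ then 1 else 0) ≤ Γ) :
    𝔼 σ, w σ * (u (b σ) - u (a σ)) ≤ 2 * Γ := by
  set I : Ω → ℝ → ℝ := fun σ => (Set.Ioo (u (a σ)) (u (b σ))).indicator fun _ => (1 : ℝ)
  have hI : ∀ σ, MeasureTheory.IntegrableOn (I σ) (Set.Icc (-1 : ℝ) 1) := fun σ =>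
    (MeasureTheory.integrableOn_const (by simp)).indicator measurableSet_Ioo
  have h1 : 𝔼 σ, w σ * (u (b σ) - u (a σ)) =
      ∫ t in Set.Icc (-1 : ℝ) 1, 𝔼 σ, w σ * I σ t := by
    simp only [Fintype.expect_eq_sum_div_card]
    rw [MeasureTheory.integral_div, MeasureTheory.integral_finsetSum _
      fun σ _ => (hI σ).const_mul (w σ)]
    congr 1
    refine Finset.sum_congr rfl fun σ _ => ?_
    rw [MeasureTheory.integral_const_mul,
      integral_indicator_Ioo (hu1' _) (hu (hab σ)) (hu1 _)]
  have h2 : ∀ t, 𝔼 σ, w σ * I σ t ≤ Γ := by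
    intro t
    by_cases ht : ∃ σ, t ∈ Set.Ioo (u (a σ)) (u (b σ))
    · obtain ⟨σ₀, h₀⟩ := ht
      obtain ⟨s, -, hs⟩ := intermediate_value_Icc (hab σ₀) hc.continuousOn ⟨h₀.1.le, h₀.2.le⟩
      refine le_trans (Finset.expect_le_expect fun σ _ => ?_) (hΓ s)
      refine mul_le_mul_of_nonneg_left ?_ (hw σ)
      simp only [I, Set.indicator]
      split_ifs with h3 h4
      · exact le_rfl
      · refine absurd ⟨?_, ?_⟩ h4
        · by_contra! h5
          have := hu h5.le
          linarith [h3.1]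
        · by_contra! h5
          have := hu h5.le
          linarith [h3.2]
      · exact zero_le_one
      · exact le_rfl
    · push Not at ht
      refine le_trans (le_of_eq ?_) ((Finset.expect_nonneg fun σ _ => ?_).trans (hΓ 0))
      · rw [Finset.expect_congr rfl fun σ _ => by
          rw [show I σ t = 0 from Set.indicator_of_notMem (ht σ) _, mul_zero]]
        simp
      · exact mul_nonneg (hw σ) (by split_ifs <;> simp)
  rw [h1]
  have h3 : MeasureTheory.IntegrableOn (fun t => 𝔼 σ, w σ * I σ t) (Set.Icc (-1 : ℝ) 1) := by
    simp only [Fintype.expect_eq_sum_div_card]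
    exact (MeasureTheory.integrable_finsetSum _ fun σ _ => (hI σ).const_mul (w σ)).div_const _
  refine (MeasureTheory.setIntegral_mono h3 (g := fun _ => Γ)
    (MeasureTheory.integrableOn_const (by simp)) h2).trans (le_of_eq ?_)
  rw [MeasureTheory.setIntegral_const, Real.volume_real_Icc_of_le (by norm_num), smul_eq_mul]
  norm_num

/-- The remainder in Stein's method, controlled by a concentration bound. -/
theorem abs_expect_stein_le {D Y c a b : Ω → ℝ} {Γ : ℝ} (z : ℝ)
    (hc : ∀ σ, c σ ∈ Set.Icc (a σ) (b σ)) (hY : ∀ σ, Y σ ∈ Set.Icc (a σ) (b σ))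
    (hYD : ∀ σ, Y σ + D σ ∈ Set.Icc (a σ) (b σ))
    (hΓ : ∀ s, 𝔼 σ, D σ ^ 2 * (if a σ ≤ s ∧ s ≤ b σ then 1 else 0) ≤ Γ) :
    |𝔼 σ, D σ * (steinSol z (Y σ + D σ) - steinSol z (Y σ)) -
      𝔼 σ, D σ ^ 2 * steinDeriv z (c σ)| ≤ 3 * Γ := by
  have h1 := expect_mul_sub_le (fun σ => sq_nonneg (D σ)) (fun σ => (hc σ).1.trans (hc σ).2)
    (monotone_mul_steinSol z) (continuous_id.mul (continuous_steinSol z))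
    (mul_steinSol_le_one z) (neg_one_le_mul_steinSol z) hΓ
  have h2 : ∀ σ, |D σ * (steinSol z (Y σ + D σ) - steinSol z (Y σ)) -
      D σ ^ 2 * steinDeriv z (c σ)| ≤
      D σ ^ 2 * (b σ * steinSol z (b σ) - a σ * steinSol z (a σ)) +
        D σ ^ 2 * (if a σ ≤ z ∧ z ≤ b σ then 1 else 0) := fun σ => by
    have h := abs_steinSol_sub_le z (hc σ) (hY σ) (hYD σ)
    rw [add_sub_cancel_left] at h
    calc _ = |D σ| * |steinSol z (Y σ + D σ) - steinSol z (Y σ) - steinDeriv z (c σ) * D σ| := by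
          rw [← abs_mul]
          congr 1
          ring
      _ ≤ |D σ| * _ := mul_le_mul_of_nonneg_left h (abs_nonneg _)
      _ = _ := by
          rw [← sq_abs (D σ)]
          ring
  rw [← Finset.expect_sub_distrib]
  refine (Finset.abs_expect_le _ _).trans ((Finset.expect_le_expect fun σ _ => h2 σ).trans ?_)
  rw [Finset.expect_add_distrib]
  linarith [hΓ z]

end Averaging

section NormalApproximation

variable {P R V : Type*} [Fintype P] [DecidableEq P] [Fintype R] [DecidableEq R] [Fintype V]
  [DecidableEq V]

variable {e : V → V → ℝ} {ε : ℝ}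

theorem sq_mul_abs_le (x y : ℝ) : x ^ 2 * |y| ≤ |x| ^ 3 + |y| ^ 3 := by
  rw [← sq_abs x]
  have hx := abs_nonneg x
  have hy := abs_nonneg y
  rcases le_total |x| |y| with h | h
  · have h1 : |x| ^ 2 * |y| ≤ |y| ^ 2 * |y| := by gcongr
    have h2 := pow_nonneg hx 3
    nlinarith
  · have h1 : |x| ^ 2 * |y| ≤ |x| ^ 2 * |x| := by gcongr
    have h2 := pow_nonneg hy 3
    nlinarith

theorem IsArr.expect_sq_quadDiff_mul_abs_le (he : IsArr e ε) (t : Fin 4 ↪ P)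
    (hPV : Nonempty (P ≃ V)) {p q : P} (hpq : p ≠ q) :
    𝔼 σ : P ≃ V, quadDiff e (fun i => σ (t i)) ^ 2 * |e (σ p) (σ q)| ≤
      128 * (ε / (Fintype.card V - 1)) := by
  have hne : ∀ i j : Fin 4, i ≠ j → t i ≠ t j := fun i j h h' => h (t.injective h')
  have h : ∀ σ : P ≃ V, quadDiff e (fun i => σ (t i)) ^ 2 * |e (σ p) (σ q)| ≤
      16 * (quadSum (fun v w => |e v w| ^ 3) (fun i => σ (t i)) + 4 * |e (σ p) (σ q)| ^ 3) := by
    intro σ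
    refine (mul_le_mul_of_nonneg_right (sq_quadDiff_le e _) (abs_nonneg _)).trans ?_
    unfold quadSum
    have h1 := sq_mul_abs_le (e (σ (t 0)) (σ (t 2))) (e (σ p) (σ q))
    have h2 := sq_mul_abs_le (e (σ (t 1)) (σ (t 3))) (e (σ p) (σ q))
    have h3 := sq_mul_abs_le (e (σ (t 0)) (σ (t 1))) (e (σ p) (σ q))
    have h4 := sq_mul_abs_le (e (σ (t 2)) (σ (t 3))) (e (σ p) (σ q))
    linarith
  have h' := Finset.expect_le_expect (s := (univ : Finset (P ≃ V))) fun σ _ => h σ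
  simp only [quadSum, ← Finset.mul_expect, Finset.expect_add_distrib] at h'
  have h1 := he.expect_cube_le hPV (hne 0 2 (by decide))
  have h2 := he.expect_cube_le hPV (hne 1 3 (by decide))
  have h3 := he.expect_cube_le hPV (hne 0 1 (by decide))
  have h4 := he.expect_cube_le hPV (hne 2 3 (by decide))
  have h5 := he.expect_cube_le hPV hpq
  linarith

theorem IsArr.expect_sq_quadDiff_mul_abs_sum_edge_le (he : IsArr e ε) (t : Fin 4 ↪ R × Bool)
    (hPV : Nonempty (R × Bool ≃ V)) (g : Equiv.Perm (R × Bool)) (s : Finset R) :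
    𝔼 σ : R × Bool ≃ V, quadDiff e (fun i => σ (t i)) ^ 2 *
        |2 * ∑ r ∈ s, edge e (g.trans σ) r| ≤
      256 * #s * (ε / (Fintype.card V - 1)) := by
  have h : ∀ σ : R × Bool ≃ V, quadDiff e (fun i => σ (t i)) ^ 2 *
      |2 * ∑ r ∈ s, edge e (g.trans σ) r| ≤
      2 * ∑ r ∈ s, quadDiff e (fun i => σ (t i)) ^ 2 *
        |e (σ (g (r, false))) (σ (g (r, true)))| := by
    intro σ
    rw [abs_mul, abs_two, ← Finset.mul_sum, mul_left_comm]
    have := mul_le_mul_of_nonneg_left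
      (Finset.abs_sum_le_sum_abs (fun r => edge e (g.trans σ) r) s)
      (sq_nonneg (quadDiff e (fun i => σ (t i))))
    exact mul_le_mul_of_nonneg_left this zero_le_two
  refine (Finset.expect_le_expect fun σ _ => h σ).trans ?_
  rw [← Finset.mul_expect, Finset.expect_sum_comm]
  have h1 : ∑ r ∈ s, 𝔼 σ : R × Bool ≃ V, quadDiff e (fun i => σ (t i)) ^ 2 *
        |e (σ (g (r, false))) (σ (g (r, true)))| ≤
      #s • (128 * (ε / (Fintype.card V - 1))) :=
    Finset.sum_le_card_nsmul _ _ _ fun r _ =>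
      he.expect_sq_quadDiff_mul_abs_le t hPV (by simp)
  rw [nsmul_eq_mul] at h1
  linarith

theorem abs_max_sub_min_le (x d y : ℝ) :
    max (max x (x + d)) y - min (min x (x + d)) y ≤ |d| + |x| + |y| := by
  rcases max_choice (max x (x + d)) y with h | h <;> rw [h] <;>
    rcases min_choice (min x (x + d)) y with h' | h' <;> rw [h'] <;>
    rcases max_choice x (x + d) with h | h <;> (try rw [h]) <;>
    rcases min_choice x (x + d) with h' | h' <;> (try rw [h']) <;>
    linarith [le_abs_self d, neg_abs_le d, le_abs_self x, neg_abs_le x, le_abs_self y,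
      neg_abs_le y]

end NormalApproximation

section NormalApproximation

variable {R V : Type*} [Fintype R] [DecidableEq R] [Fintype V] [DecidableEq V]

variable {e : V → V → ℝ} {ε : ℝ}

/-- The disjoint blocks of four positions outside six distinguished edges. -/
def blockEmbedding {κ : Type*} {M : ℕ} (j : κ ⊕ Fin M × Bool ↪ R) : Fin M × Fin 4 ↪ R × Bool where
  toFun x := quadPos (j (Sum.inr (x.1, false))) (j (Sum.inr (x.1, true))) x.2
  inj' := by
    rintro ⟨k, i⟩ ⟨k', i'⟩ h
    fin_cases i <;> fin_cases i' <;> simp_all [quadPos]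

theorem blockEmbedding_fst {κ : Type*} {M : ℕ} (j : κ ⊕ Fin M × Bool ↪ R) (x : Fin M × Fin 4) :
    ∃ b, (blockEmbedding j x).1 = j (Sum.inr (x.1, b)) := by
  obtain ⟨k, i⟩ := x
  fin_cases i
  exacts [⟨false, rfl⟩, ⟨false, rfl⟩, ⟨true, rfl⟩, ⟨true, rfl⟩]

/-- Concentration of the matching sum around a perturbation involving six edges only. -/
theorem IsArr.matchSum_concentration (he : IsArr e ε) {M : ℕ}
    (hM : 4 * (M : ℝ) ≤ Fintype.card V) (hM' : (Fintype.card V : ℝ) ≤ 4 * M + 20)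
    (j : Fin 6 ⊕ Fin M × Bool ↪ R) {s : Finset R} (hs : s = univ.map (Function.Embedding.inl.trans j))
    {w lo hi : (R × Bool ≃ V) → ℝ} (hw0 : ∀ σ, 0 ≤ w σ) (hlh : ∀ σ, lo σ ≤ hi σ)
    (hw : LocalOn (s ×ˢ univ) w) (hlo : LocalOn (s ×ˢ univ) lo) (hhi : LocalOn (s ×ˢ univ) hi)
    (z : ℝ) :
    𝔼 σ, w σ * (if 2 * ∑ r ∈ sᶜ, edge e σ r + lo σ ≤ z ∧ z ≤ 2 * ∑ r ∈ sᶜ, edge e σ r + hi σ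
        then 1 else 0) ≤
      𝔼 σ, w σ * (2 * (hi σ - lo σ) + 500 * ε) := by
  have hjs : ∀ x, j (Sum.inr x) ∉ s := by
    intro x hx
    rw [hs, mem_map] at hx
    obtain ⟨a, -, ha⟩ := hx
    have := j.injective ha
    simp at this
  have hB : ∀ x, blockEmbedding j x ∉ s ×ˢ (univ : Finset Bool) := by
    intro x hx
    obtain ⟨b, hb⟩ := blockEmbedding_fst j x
    rw [mem_product, hb] at hx
    exact hjs _ hx.1
  have hcard : #(s ×ˢ (univ : Finset Bool)) ≤ 12 := by
    rw [card_product, hs, card_map]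
    simp
  have h := he.concentration (Z := fun σ => 2 * ∑ r ∈ sᶜ, edge e σ r + hi σ - z)
    (ℓ := fun σ => hi σ - lo σ) hcard hM hM' (blockEmbedding j) hB hw0
    (fun σ => sub_nonneg.2 (hlh σ)) hw
    (fun g hg σ => by simp only [hlo g hg, hhi g hg]) (by
      intro k σ
      have hloc : ∀ p ∈ s ×ˢ (univ : Finset Bool),
          Equiv.swap (blockEmbedding j (k, 1)) (blockEmbedding j (k, 2)) p = p := by
        intro p hp
        exact Equiv.swap_apply_of_ne_of_ne (fun h => hB _ (h ▸ hp)) (fun h => hB _ (h ▸ hp))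
      have hne : j (Sum.inr (k, false)) ≠ j (Sum.inr (k, true)) := fun h => by
        have := j.injective h
        simp at this
      have h1 := sum_edge_swap (e := e) sᶜ (mem_compl.2 (hjs (k, false)))
        (mem_compl.2 (hjs (k, true))) hne σ
      have h2 := hhi _ hloc σ
      change 2 * ∑ x ∈ sᶜ, edge e ((Equiv.swap (blockEmbedding j (k, 1))
        (blockEmbedding j (k, 2))).trans σ) x = 2 * ∑ x ∈ sᶜ, edge e σ x +
          quadDiff e (fun i => σ (blockEmbedding j (k, i))) at h1
      rw [h1, h2]
      ring)
  refine le_trans (le_of_eq (Finset.expect_congr rfl fun σ _ => ?_)) h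
  congr 1
  refine if_congr ⟨fun h => ⟨by linarith, by linarith⟩, fun h => ⟨by linarith, by linarith⟩⟩ rfl rfl

theorem IsArr.abs_expect_matchSum_le_sub (he : IsArr e ε) (hε1 : ε ≤ 1)
    (hPV : Nonempty (R × Bool ≃ V)) (z : ℝ) :
    |𝔼 σ : R × Bool ≃ V, (if matchSum e σ ≤ z then (1 : ℝ) else 0) - stdNormalCDF z| ≤
      11000 * ε := by
  have hl := he.large
  have hε := he.pos
  have hinv := he.inv_le
  have hcard : (Fintype.card V : ℝ) = 2 * Fintype.card R := by
    rw [← card_eq hPV, Fintype.card_prod, Fintype.card_bool]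
    push_cast
    ring
  have hR : 1000 ≤ Fintype.card R := by
    have : (1000 : ℝ) ≤ Fintype.card R := by linarith
    exact_mod_cast this
  obtain ⟨M, hM⟩ : ∃ M, M = (Fintype.card R - 6) / 2 := ⟨_, rfl⟩
  have hM1 : 4 * (M : ℝ) ≤ Fintype.card V := by
    rw [hcard]
    have : 4 * M ≤ 2 * Fintype.card R := by omega
    exact_mod_cast this
  have hM2 : (Fintype.card V : ℝ) ≤ 4 * M + 20 := by
    rw [hcard]
    have : 2 * Fintype.card R ≤ 4 * M + 20 := by omega
    exact_mod_cast this
  obtain ⟨j⟩ : Nonempty (Fin 6 ⊕ Fin M × Bool ↪ R) := by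
    refine Function.Embedding.nonempty_of_card_le ?_
    simp only [Fintype.card_sum, Fintype.card_prod, Fintype.card_fin, Fintype.card_bool]
    omega
  set s : Finset R := univ.map (Function.Embedding.inl.trans j) with hs
  have hjs : ∀ a, j (Sum.inl a) ∈ s := fun a => by
    rw [hs, mem_map]
    exact ⟨a, mem_univ _, rfl⟩
  have hsc : #s = 6 := by rw [hs, card_map, card_univ, Fintype.card_fin]
  have h01 : j (Sum.inl 0) ≠ j (Sum.inl 1) := fun h => by
    have := j.injective h
    simp at this
  set t : Fin 4 ↪ R × Bool := ⟨quadPos (j (Sum.inl 0)) (j (Sum.inl 1)), quadPos_injective h01⟩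
    with ht
  set q : Fin 4 ↪ R × Bool := ⟨fun i => (j (Sum.inl (Fin.natAdd 2 i)), false), fun a b h => by
    exact Fin.natAdd_injective 4 2 (Sum.inl_injective (j.injective (Prod.ext_iff.1 h).1))⟩ with hq
  have hq1 : Function.Injective fun i => (q i).1 := fun a b h => by
    exact Fin.natAdd_injective 4 2 (Sum.inl_injective (j.injective h))
  set A : Finset (R × Bool) := s ×ˢ univ with hA
  have htA : ∀ i, t i ∈ A := by
    intro i
    rw [hA, mem_product]
    refine ⟨?_, mem_univ _⟩
    fin_cases i
    exacts [hjs 0, hjs 0, hjs 1, hjs 1]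
  have hqA : ∀ i, q i ∈ A := fun i => mem_product.2 ⟨hjs _, mem_univ _⟩
  obtain ⟨θ, hθA, hθ⟩ := exists_perm_of_embeddings Aᶜ q t (by simpa using hqA) (by simpa using htA)
  have hθA' : ∀ p ∈ A, θ p ∈ A := by
    intro p hp
    by_contra h
    have := θ.injective (hθA _ (mem_compl.2 h))
    exact h (this.symm ▸ hp)
  -- the local functionals
  set D : (R × Bool ≃ V) → ℝ := fun σ => quadDiff e (fun i => σ (t i)) with hD
  set W : (R × Bool ≃ V) → ℝ := fun σ => 2 * ∑ r ∈ sᶜ, edge e σ r with hW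
  set L : (R × Bool ≃ V) → ℝ := fun σ => 2 * ∑ r ∈ s, edge e σ r with hL
  set K : (R × Bool ≃ V) → ℝ := fun σ => 2 * ∑ r ∈ s, edge e (θ.trans σ) r with hK
  have hDl : LocalOn A D := localOn_of_forall fun σ τ h => by
    simp only [hD, fun i => h (t i) (htA i)]
  have hsA : ∀ r ∈ s, ∀ b, (r, b) ∈ A := fun r hr b => mem_product.2 ⟨hr, mem_univ _⟩
  have hLl : LocalOn A L := localOn_of_forall fun σ τ h => by
    simp only [hL]
    congr 1
    refine Finset.sum_congr rfl fun r hr => ?_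
    unfold edge
    rw [h _ (hsA r hr _), h _ (hsA r hr _)]
  have hKl : LocalOn A K := localOn_of_forall fun σ τ h => by
    simp only [hK]
    congr 1
    refine Finset.sum_congr rfl fun r hr => ?_
    unfold edge
    simp only [Equiv.trans_apply]
    rw [h _ (hθA' _ (hsA r hr _)), h _ (hθA' _ (hsA r hr _))]
  have hYWL : ∀ σ : R × Bool ≃ V, matchSum e σ = W σ + L σ := fun σ => by
    rw [matchSum_eq he.symm, hW, hL, ← Finset.sum_compl_add_sum s, mul_add]
  have hYθ : ∀ σ : R × Bool ≃ V, matchSum e (θ.trans σ) = W σ + K σ := fun σ => by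
    rw [hYWL]
    congr 1
    simp only [hW]
    congr 1
    refine Finset.sum_congr rfl fun r hr => ?_
    have h : ∀ b, θ (r, b) = (r, b) := fun b => hθA _ (mem_compl.2 fun h =>
      mem_compl.1 hr (mem_product.1 h).1)
    unfold edge
    simp only [Equiv.trans_apply, h]
  set lo : (R × Bool ≃ V) → ℝ := fun σ => min (min (L σ) (L σ + D σ)) (K σ) with hlo
  set hi : (R × Bool ≃ V) → ℝ := fun σ => max (max (L σ) (L σ + D σ)) (K σ) with hhi
  have hlh : ∀ σ, lo σ ≤ hi σ := fun σ => (min_le_right _ _).trans (le_max_right _ _)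
  have hlol : LocalOn A lo := fun g hg σ => by
    simp only [hlo, hLl g hg, hDl g hg, hKl g hg]
  have hhil : LocalOn A hi := fun g hg σ => by
    simp only [hhi, hLl g hg, hDl g hg, hKl g hg]
  have hconc := fun z => he.matchSum_concentration hM1 hM2 j hs
    (w := fun σ => D σ ^ 2) (fun σ => sq_nonneg _) hlh
    (fun g hg σ => by simp only [hDl g hg]) hlol hhil z
  obtain ⟨Γ, hΓ⟩ : ∃ Γ, 𝔼 σ, D σ ^ 2 * (2 * (hi σ - lo σ) + 500 * ε) = Γ := ⟨_, rfl⟩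
  simp only [hΓ] at hconc
  have hstein := abs_expect_stein_le (D := D) (Y := fun σ => matchSum e σ)
    (c := fun σ => matchSum e (θ.trans σ)) (a := fun σ => W σ + lo σ) (b := fun σ => W σ + hi σ)
    z
    (fun σ => by
      rw [hYθ]
      exact ⟨add_le_add_right (min_le_right _ _) _, add_le_add_right (le_max_right _ _) _⟩)
    (fun σ => by
      rw [hYWL]
      exact ⟨add_le_add_right ((min_le_left _ _).trans (min_le_left _ _)) _,
        add_le_add_right ((le_max_left _ _).trans' (le_max_left _ _)) _⟩)
    (fun σ => by
      rw [hYWL, add_assoc]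
      exact ⟨add_le_add_right ((min_le_left _ _).trans (min_le_right _ _)) _,
        add_le_add_right ((le_max_left _ _).trans' (le_max_right _ _)) _⟩) hconc
  -- decoupling
  have hdec := abs_expect_decouple_le (e := e) hPV (by omega) (fun x => quadDiff e x ^ 2)
    (fun x => sq_nonneg _) (abs_steinDeriv_le z) q t hq1
  have hT : 𝔼 σ : R × Bool ≃ V, quadDiff e (fun i => σ (q i)) ^ 2 *
      steinDeriv z (matchSum e σ) =
      𝔼 σ : R × Bool ≃ V, D σ ^ 2 * steinDeriv z (matchSum e (θ.trans σ)) := by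
    rw [← expect_perm θ]
    simp only [Equiv.trans_apply, hθ, hD]
  rw [hT] at hdec
  have hexch := he.expect_matchSum_mul h01 hPV (steinSol z)
  change _ = _ * 𝔼 σ : R × Bool ≃ V, D σ * (steinSol z (matchSum e σ + D σ) -
    steinSol z (matchSum e σ)) at hexch
  have hD2 := he.expect_sq_quadDiff t hPV
  change 𝔼 σ : R × Bool ≃ V, D σ ^ 2 = _ at hD2
  have hG : 𝔼 σ : R × Bool ≃ V, steinDeriv z (matchSum e σ) =
      𝔼 σ : R × Bool ≃ V, matchSum e σ * steinSol z (matchSum e σ) +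
      (𝔼 σ : R × Bool ≃ V, (if matchSum e σ ≤ z then (1 : ℝ) else 0) - stdNormalCDF z) := by
    unfold steinDeriv
    rw [Finset.expect_sub_distrib, Finset.expect_add_distrib, Fintype.expect_const]
    ring
  -- the size of the concentration bound
  have hΓle : Γ ≤ 2 * (3584 * (ε / (Fintype.card V - 1))) +
      500 * ε * 𝔼 σ : R × Bool ≃ V, D σ ^ 2 := by
    have h1 : ∀ σ, D σ ^ 2 * (2 * (hi σ - lo σ) + 500 * ε) ≤
        2 * (|D σ| ^ 3 + D σ ^ 2 * |L σ| + D σ ^ 2 * |K σ|) + 500 * ε * D σ ^ 2 := fun σ => by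
      have h2 := mul_le_mul_of_nonneg_left (abs_max_sub_min_le (L σ) (D σ) (K σ)) (sq_nonneg (D σ))
      have h3 : D σ ^ 2 * |D σ| = |D σ| ^ 3 := by
        rw [← sq_abs]
        ring
      simp only [hlo, hhi]
      linarith
    have h2 := Finset.expect_le_expect (s := (univ : Finset (R × Bool ≃ V))) fun σ _ => h1 σ
    rw [hΓ] at h2
    simp only [Finset.expect_add_distrib, ← Finset.mul_expect] at h2
    have h3 := he.expect_cube_quadDiff_le t hPV
    have h4 := he.expect_sq_quadDiff_mul_abs_sum_edge_le t hPV (Equiv.refl _) s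
    have h5 := he.expect_sq_quadDiff_mul_abs_sum_edge_le t hPV θ s
    rw [hsc] at h4 h5
    change 𝔼 σ : R × Bool ≃ V, D σ ^ 2 * |L σ| ≤ _ at h4
    change 𝔼 σ : R × Bool ≃ V, D σ ^ 2 * |K σ| ≤ _ at h5
    change 𝔼 σ : R × Bool ≃ V, |D σ| ^ 3 ≤ _ at h3
    push_cast at h4 h5
    linarith
  change |(𝔼 σ : R × Bool ≃ V, D σ ^ 2) * _ - _| ≤ _ * 𝔼 σ : R × Bool ≃ V, D σ ^ 2 at hdec
  rw [hG, hexch] at hdec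
  generalize 𝔼 σ : R × Bool ≃ V, (if matchSum e σ ≤ z then (1 : ℝ) else 0) - stdNormalCDF z = Δ at *
  generalize 𝔼 σ : R × Bool ≃ V, D σ * (steinSol z (matchSum e σ + D σ) -
    steinSol z (matchSum e σ)) = x at *
  generalize 𝔼 σ : R × Bool ≃ V, D σ ^ 2 * steinDeriv z (matchSum e (θ.trans σ)) = y at *
  generalize 𝔼 σ : R × Bool ≃ V, D σ ^ 2 = m at *
  generalize (Fintype.card V : ℝ) = n at *
  clear_value D W L K lo hi
  have hn1 : 0 < n - 1 := by linarith
  have hn2 : 0 < n - 2 := by linarith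
  have hn3 : 0 < n - 3 := by linarith
  have hm : 0 < m := by
    rw [hD2]
    exact div_pos (by linarith) (mul_pos (by linarith) hn2)
  have hmx : m * (n * (n - 2) / (8 * (n - 1)) * x + Δ) = x + m * Δ := by
    rw [hD2]
    have h0 : n ≠ 0 := by linarith
    have h1 := hn1.ne'
    have h2 := hn2.ne'
    field_simp
  have hm8 : ε / (n - 1) ≤ ε * m / 8 := by
    rw [hD2, div_le_div_iff₀ hn1 (by norm_num), mul_assoc]
    refine mul_le_mul_of_nonneg_left ?_ hε.le
    rw [div_mul_eq_mul_div, le_div_iff₀ (mul_pos (by linarith) hn2)]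
    nlinarith
  have h96 : 32 * 3 / (n - 3) ≤ 6812 * ε := by
    rw [div_le_iff₀ hn3]
    have h1 : ε ^ 2 * n ≤ ε * n := by
      have : ε ^ 2 ≤ ε := by nlinarith
      exact mul_le_mul_of_nonneg_right this (by linarith)
    have h2 : ε * (99 / 100 * n) ≤ ε * (n - 3) := mul_le_mul_of_nonneg_left (by linarith) hε.le
    linarith
  rw [hmx] at hdec
  have h96m := mul_le_mul_of_nonneg_right h96 hm.le
  have h1 : m * |Δ| ≤ m * (11000 * ε) := by
    rw [← abs_of_pos hm, ← abs_mul, abs_of_pos hm]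
    rw [abs_le] at hdec hstein ⊢
    constructor <;> linarith
  exact le_of_mul_le_mul_left h1 hm

end NormalApproximation

section Involutions

variable {N n : ℕ}

/-- The exchange of the two positions of each edge. -/
def flipPerm (N : ℕ) : Equiv.Perm (Fin N × Bool) := pairPerm (Equiv.refl _) fun _ => true

theorem flipPerm_apply (p : Fin N × Bool) : flipPerm N p = (p.1, !p.2) := by
  obtain ⟨r, b⟩ := p
  simp [flipPerm, pairPerm_apply]

/-- The involution matching the labels of each edge. -/
def labelInvolution (σ : Fin N × Bool ≃ Fin n) : Equiv.Perm (Fin n) :=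
  σ.symm.trans ((flipPerm N).trans σ)

theorem labelInvolution_apply (σ : Fin N × Bool ≃ Fin n) (p : Fin N × Bool) :
    labelInvolution σ (σ p) = σ (p.1, !p.2) := by
  simp [labelInvolution, flipPerm_apply]

theorem labelInvolution_mem (σ : Fin N × Bool ≃ Fin n) :
    labelInvolution σ ∈ fpfInvolutions n := by
  simp only [fpfInvolutions, mem_filter, mem_univ, true_and]
  constructor
  · ext1 i
    obtain ⟨p, rfl⟩ := σ.surjective i
    rw [Equiv.Perm.mul_apply, labelInvolution_apply, labelInvolution_apply]
    simp
  · intro i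
    obtain ⟨p, rfl⟩ := σ.surjective i
    rw [labelInvolution_apply]
    intro h
    have := congrArg Prod.snd (σ.injective h)
    simp at this

theorem matchSum_eq_labelInvolution (e : Fin n → Fin n → ℝ) (σ : Fin N × Bool ≃ Fin n) :
    matchSum e σ = ∑ i, e i (labelInvolution σ i) := by
  rw [← Equiv.sum_comp σ]
  simp only [labelInvolution_apply, matchSum]

theorem cycleType_of_mem_fpfInvolutions {π : Equiv.Perm (Fin n)} (hπ : π ∈ fpfInvolutions n) :
    π.cycleType = Multiset.replicate (n / 2) 2 := by
  simp only [fpfInvolutions, mem_filter, mem_univ, true_and] at hπ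
  have h1 : ∀ c ∈ π.cycleType, c = 2 :=
    (Equiv.Perm.pow_prime_eq_one_iff (p := 2)).1 (by rw [pow_two]; exact hπ.1)
  have h2 := Multiset.eq_replicate_card.2 h1
  have h3 := π.sum_cycleType
  have h4 : π.support = univ := by
    ext i
    simpa using hπ.2 i
  rw [h4, card_univ, Fintype.card_fin, h2, Multiset.sum_replicate, smul_eq_mul] at h3
  rw [h2]
  congr 1
  omega

theorem card_filter_labelInvolution_eq {π π' : Equiv.Perm (Fin n)} (hπ : π ∈ fpfInvolutions n)
    (hπ' : π' ∈ fpfInvolutions n) :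
    #{σ : Fin N × Bool ≃ Fin n | labelInvolution σ = π} =
      #{σ : Fin N × Bool ≃ Fin n | labelInvolution σ = π'} := by
  obtain ⟨ρ, hρ⟩ := isConj_iff.1 (Equiv.Perm.isConj_iff_cycleType_eq.2
    ((cycleType_of_mem_fpfInvolutions hπ).trans (cycleType_of_mem_fpfInvolutions hπ').symm))
  have hL : ∀ σ : Fin N × Bool ≃ Fin n,
      labelInvolution (σ.trans ρ) = ρ * labelInvolution σ * ρ⁻¹ := fun σ => by
    ext1 i
    rfl
  refine Finset.card_bij' (fun σ _ => σ.trans ρ) (fun σ _ => σ.trans ρ.symm) ?_ ?_ ?_ ?_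
  · intro σ hσ
    simp only [mem_filter, mem_univ, true_and] at hσ ⊢
    rw [hL, hσ, hρ]
  · intro σ hσ
    simp only [mem_filter, mem_univ, true_and] at hσ ⊢
    have h1 := hL (σ.trans ρ.symm)
    rw [show (σ.trans ρ.symm).trans ρ = σ by ext; simp, hσ, ← hρ] at h1
    exact (mul_left_cancel (mul_right_cancel h1)).symm
  · intro σ _
    ext
    simp
  · intro σ _
    ext
    simp

/-- The distribution of the involution statistic as that of the matching sum. -/
theorem cdfYE_eq_expect (e : Fin n → Fin n → ℝ) (t : ℝ)
    (hσ : Nonempty (Fin N × Bool ≃ Fin n)) :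
    cdfYE n e t = 𝔼 σ : Fin N × Bool ≃ Fin n, (if matchSum e σ ≤ t then (1 : ℝ) else 0) := by
  obtain ⟨σ₀⟩ := hσ
  obtain ⟨c, hc⟩ : ∃ c, #{σ : Fin N × Bool ≃ Fin n | labelInvolution σ = labelInvolution σ₀} = c :=
    ⟨_, rfl⟩
  have hc0 : (c : ℝ) ≠ 0 := by
    rw [← hc, Nat.cast_ne_zero]
    exact Finset.card_ne_zero_of_mem (a := σ₀) (by simp)
  have hsum : ∀ F : Equiv.Perm (Fin n) → ℝ,
      ∑ σ : Fin N × Bool ≃ Fin n, F (labelInvolution σ) = c * ∑ π ∈ fpfInvolutions n, F π := by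
    intro F
    rw [← Finset.sum_fiberwise_of_maps_to (s := univ) (t := fpfInvolutions n)
      (g := fun σ : Fin N × Bool ≃ Fin n => labelInvolution σ) fun σ _ => labelInvolution_mem σ,
      Finset.mul_sum]
    refine Finset.sum_congr rfl fun π hπ => ?_
    rw [Finset.sum_congr rfl fun σ hσ => by rw [(mem_filter.1 hσ).2], Finset.sum_const,
      card_filter_labelInvolution_eq hπ (labelInvolution_mem σ₀), hc, nsmul_eq_mul]
  rw [Fintype.expect_eq_sum_div_card]
  have h1 := hsum fun π => if ∑ i, e i (π i) ≤ t then 1 else 0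
  have h2 := hsum fun _ => 1
  simp only [Finset.sum_const, card_univ, nsmul_eq_mul, mul_one] at h2
  simp only [matchSum_eq_labelInvolution]
  rw [h1, h2, mul_div_mul_left _ _ hc0, cdfYE, Finset.sum_boole]

end Involutions

section Bound

variable {n : ℕ} {γ : ℝ} {e : Fin n → Fin n → ℝ}

theorem sq_le_sq_add_cube_div (x : ℝ) {θ : ℝ} (hθ : 0 < θ) : x ^ 2 ≤ θ ^ 2 + |x| ^ 3 / θ := by
  have h0 := abs_nonneg x
  rw [← sq_abs]
  rcases le_total |x| θ with h | h
  · have h1 : |x| ^ 2 ≤ θ ^ 2 := by gcongr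
    have h2 : 0 ≤ |x| ^ 3 / θ := by positivity
    linarith
  · have h1 : |x| ^ 2 ≤ |x| ^ 3 / θ := by
      rw [le_div_iff₀ hθ]
      calc |x| ^ 2 * θ ≤ |x| ^ 2 * |x| := by gcongr
        _ = |x| ^ 3 := by ring
    have h2 := sq_nonneg θ
    linarith

theorem isArr_of_memM (h : memM n γ e) (hn : 1000 ≤ n) (hγ : 0 < γ)
    (hε : 2804655 * (γ / n) ≤ 1) : IsArr e (γ / n) := by
  obtain ⟨hs, hd, hr, hsq, hcube⟩ := h
  have hn' : (1000 : ℝ) ≤ n := by exact_mod_cast hn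
  have hn0 : (0 : ℝ) < n := by linarith
  have hcube' : ∑ v, ∑ w, |e v w| ^ 3 ≤ n * (γ / n) := by
    rw [mul_div_cancel₀ _ hn0.ne']
    refine le_trans (le_of_eq ?_) hcube
    refine Finset.sum_congr rfl fun i _ => Finset.sum_congr rfl fun j _ => ?_
    split_ifs with hij
    · rfl
    · rw [not_not] at hij
      rw [hij, hd]
      simp
  have hpos : 0 < γ / n := by positivity
  generalize γ / (n : ℝ) = ε at *
  have hsq' : ∑ v, ∑ w, e v w ^ 2 = ((n : ℝ) - 1) * (n - 3) / (2 * (n - 2)) := by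
    have h1 : (n : ℝ) - 1 ≠ 0 := by linarith
    have h2 : (n : ℝ) - 2 ≠ 0 := by linarith
    have h3 : (n : ℝ) - 3 ≠ 0 := by linarith
    field_simp at hsq ⊢
    linarith
  have hinv : 1 ≤ 70 * ε ^ 2 * n := by
    set θ : ℝ := (2 * √n)⁻¹ with hθ
    have hsn : 0 < √(n : ℝ) := Real.sqrt_pos.2 hn0
    have hss : √(n : ℝ) * √n = n := Real.mul_self_sqrt hn0.le
    have hθ0 : 0 < θ := by positivity
    have h1 : ∑ v, ∑ w, e v w ^ 2 ≤ ∑ v : Fin n, ∑ w : Fin n, (θ ^ 2 + |e v w| ^ 3 / θ) :=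
      Finset.sum_le_sum fun v _ => Finset.sum_le_sum fun w _ => sq_le_sq_add_cube_div _ hθ0
    simp only [Finset.sum_add_distrib, ← Finset.sum_div, Finset.sum_const, card_univ,
      Fintype.card_fin, nsmul_eq_mul] at h1
    have h2 : (∑ v, ∑ w, |e v w| ^ 3) / θ ≤ n * ε / θ := by gcongr
    have h3 : 49 / 100 * (n : ℝ) ≤ ∑ v, ∑ w, e v w ^ 2 := by
      rw [hsq', le_div_iff₀ (by linarith)]
      nlinarith
    have h4 : (n : ℝ) * (n * θ ^ 2) = n / 4 := by
      rw [hθ, inv_pow, mul_pow, Real.sq_sqrt hn0.le]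
      field_simp
      norm_num
    have h5 : n * ε / θ = n * (2 * (√n * ε)) := by
      rw [hθ, div_inv_eq_mul]
      ring
    have h6 : (n : ℝ) * (24 / 100) ≤ n * (2 * (√n * ε)) := by linarith
    have h7 := le_of_mul_le_mul_left h6 hn0
    have h8 : ε ^ 2 * n = (√n * ε) ^ 2 := by
      rw [mul_pow, Real.sq_sqrt hn0.le]
      ring
    rw [mul_assoc, h8]
    nlinarith
  refine ⟨hs, hd, hr, ?_, ?_, fun v => ?_, ?_, hpos, ?_⟩ <;> rw [Fintype.card_fin]
  · exact hsq'
  · exact hcube'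
  · have h1 : ∑ w, e v w ^ 2 ≤ ∑ w : Fin n, ((1 / 100) ^ 2 + |e v w| ^ 3 / (1 / 100)) :=
      Finset.sum_le_sum fun w _ => sq_le_sq_add_cube_div _ (by norm_num)
    simp only [Finset.sum_add_distrib, ← Finset.sum_div, Finset.sum_const, card_univ,
      Fintype.card_fin, nsmul_eq_mul] at h1
    have h2 : ∑ w, |e v w| ^ 3 ≤ ∑ v, ∑ w, |e v w| ^ 3 :=
      Finset.single_le_sum (f := fun v => ∑ w, |e v w| ^ 3)
        (fun v _ => Finset.sum_nonneg fun w _ => by positivity) (mem_univ v)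
    have h3 : (n : ℝ) * ε ≤ n * (1 / 2804655) :=
      mul_le_mul_of_nonneg_left (by linarith) hn0.le
    linarith
  · have h1 : ε ^ 2 ≤ (1 / 2804655) ^ 2 := by
      gcongr
      linarith
    have h2 := mul_le_mul_of_nonneg_right h1 hn0.le
    nlinarith
  · exact hinv

theorem cdfYE_nonneg (t : ℝ) : 0 ≤ cdfYE n e t := by
  unfold cdfYE
  positivity

theorem cdfYE_le_one (t : ℝ) : cdfYE n e t ≤ 1 :=
  div_le_one_of_le₀ (Nat.cast_le.2 (Finset.card_filter_le _ _)) (Nat.cast_nonneg _)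

theorem abs_cdfYE_sub_le (h : memM n γ e) (hn : Even n) (hn1000 : 1000 ≤ n) (hγ : 0 < γ)
    (t : ℝ) : |cdfYE n e t - stdNormalCDF t| ≤ 2804655 * (γ / n) := by
  rcases le_total (2804655 * (γ / n)) 1 with hε | hε
  · have he := isArr_of_memM h hn1000 hγ hε
    obtain ⟨N, rfl⟩ := hn
    have hσ : Nonempty (Fin N × Bool ≃ Fin (N + N)) :=
      ⟨Fintype.equivOfCardEq (by simp; omega)⟩
    rw [cdfYE_eq_expect e t hσ]
    have hpos := he.pos
    refine (he.abs_expect_matchSum_le_sub (by linarith) hσ t).trans ?_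
    linarith
  · refine le_trans ?_ hε
    have h1 := cdfYE_nonneg (n := n) (e := e) t
    have h2 := cdfYE_le_one (n := n) (e := e) t
    have h3 := stdNormalCDF_nonneg t
    have h4 := stdNormalCDF_le_one t
    rw [abs_le]
    constructor <;> linarith

end Bound

end Matching

/-- `δ¹(γ, n) ≤ 2804655 γ / n` for every even `n ≥ 1000` and `γ > 0`. -/
theorem delta1_bound (n : ℕ) (hn : Even n) (hn1000 : 1000 ≤ n) (γ : ℝ) (hγ : 0 < γ) :
    delta1 γ n ≤ 2804655 * γ / n := by
  rw [mul_div_assoc]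
  have h0 : 0 ≤ 2804655 * (γ / n) := by positivity
  exact Real.iSup_le (fun e => Real.iSup_le
    (fun t => Matching.abs_cdfYE_sub_le e.2.1 hn hn1000 hγ t) h0) h0
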